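/- Main theorem: For n ≥ 2 there exists a compact subset S ⊆ ℝ^n of Lebesgue measure zero such that every Lipschitz function g : ℝ^n → ℝ is Fréchet differentiable at some point of S. -/

import Mathlib

open MeasureTheory

section

open Set Filter Topology
open scoped NNReal ENNReal

lemma weak_type_of_closedBall (ν : Measure ℝ) [IsFiniteMeasure ν] (B : Set ℝ) {c : ℝ}
    (hc : 0 < c)
    (h : ∀ τ ∈ B, ∃ r, 0 < r ∧ ENNReal.ofReal (c * r) ≤ ν (Metric.closedBall τ r)) :
    ENNReal.ofReal c * volume B ≤ 10 * ν univ := by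
  choose! r hr0 hr using h
  have hbd : ∀ a ∈ B, r a ≤ (ν univ).toReal / c := by
    intro a ha
    rw [le_div_iff₀ hc, mul_comm]
    have h1 := (hr a ha).trans (measure_mono (subset_univ _))
    exact (ENNReal.ofReal_le_iff_le_toReal (measure_ne_top ν _)).1 h1
  obtain ⟨u, huB, hdisj, hcov⟩ := Vitali.exists_disjoint_subfamily_covering_enlargement_closedBall
    B id r _ hbd 5 (by norm_num)
  have hcount : u.Countable := by
    apply hdisj.countable_of_nonempty_interior
    intro a ha
    rw [id, interior_closedBall _ (hr0 a (huB ha)).ne']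
    exact Metric.nonempty_ball.2 (hr0 a (huB ha))
  have hsub : B ⊆ ⋃ a ∈ u, Metric.closedBall a (5 * r a) := by
    intro a ha
    obtain ⟨b, hb, hab⟩ := hcov a ha
    refine mem_iUnion₂.2 ⟨b, hb, hab ?_⟩
    simpa using (hr0 a ha).le
  have := hcount.to_subtype
  calc ENNReal.ofReal c * volume B
      ≤ ENNReal.ofReal c * ∑' a : u, volume (Metric.closedBall (a : ℝ) (5 * r a)) := by
        gcongr
        exact (measure_mono hsub).trans (measure_biUnion_le _ hcount _)
    _ = ∑' a : u, 10 * ENNReal.ofReal (c * r a) := by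
        rw [← ENNReal.tsum_mul_left]
        congr 1; ext a
        rw [Real.volume_closedBall, ENNReal.ofReal_mul hc.le]
        rw [show (2 : ℝ) * (5 * r a) = 10 * r a by ring, ENNReal.ofReal_mul (by norm_num)]
        simp; ring
    _ ≤ ∑' a : u, 10 * ν (Metric.closedBall (a : ℝ) (r a)) := by
        gcongr with a
        exact hr a (huB a.2)
    _ = 10 * ν (⋃ a ∈ u, Metric.closedBall (a : ℝ) (r a)) := by
        rw [ENNReal.tsum_mul_left,
          measure_biUnion (f := fun a => Metric.closedBall a (r a)) hcount hdisj
            (fun a _ => Metric.isClosed_closedBall.measurableSet)]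
    _ ≤ 10 * ν univ := by gcongr; exact subset_univ _

lemma LipschitzWith.intervalIntegral_deriv {C : ℝ≥0} {h : ℝ → ℝ} (hL : LipschitzWith C h)
    (a b : ℝ) : ∫ t in a..b, deriv h t = h b - h a :=
  AbsolutelyContinuousOnInterval.integral_deriv_eq_sub
    (hL.lipschitzOnWith.absolutelyContinuousOnInterval)

lemma LipschitzWith.abs_deriv_le {C : ℝ≥0} {h : ℝ → ℝ} (hL : LipschitzWith C h) (t : ℝ) :
    |deriv h t| ≤ C := norm_deriv_le_of_lipschitz hL

lemma LipschitzWith.intervalIntegrable_deriv {C : ℝ≥0} {h : ℝ → ℝ} (hL : LipschitzWith C h)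
    (a b : ℝ) : IntervalIntegrable (deriv h) volume a b := by
  refine (intervalIntegrable_const (c := (C : ℝ))).mono_fun
    (measurable_deriv h).aestronglyMeasurable ?_
  exact ae_of_all _ fun t => by simpa using hL.abs_deriv_le t

lemma LipschitzWith.sq_sub_le_integral {C : ℝ≥0} {h : ℝ → ℝ} (hL : LipschitzWith C h)
    {a b : ℝ} (hab : a < b) :
    (h b - h a) ^ 2 ≤ (b - a) * ∫ t in a..b, deriv h t ^ 2 := by
  set m := (h b - h a) / (b - a)
  have hi := hL.intervalIntegrable_deriv a b
  have hi2 : IntervalIntegrable (fun t => deriv h t ^ 2) volume a b := by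
    refine (intervalIntegrable_const (c := (C : ℝ) ^ 2)).mono_fun
      ((measurable_deriv h).pow_const 2).aestronglyMeasurable ?_
    refine ae_of_all _ fun t => ?_
    have := hL.abs_deriv_le t
    simp only [norm_pow, Real.norm_eq_abs, NNReal.abs_eq]
    gcongr
  have h0 : 0 ≤ ∫ t in a..b, (deriv h t - m) ^ 2 :=
    intervalIntegral.integral_nonneg hab.le fun t _ => sq_nonneg _
  have h1 : ∫ t in a..b, (deriv h t - m) ^ 2
      = (∫ t in a..b, deriv h t ^ 2) - 2 * m * (h b - h a) + m ^ 2 * (b - a) := by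
    rw [← hL.intervalIntegral_deriv a b, ← intervalIntegral.integral_const_mul,
      ← intervalIntegral.integral_sub hi2 (hi.const_mul _)]
    have : m ^ 2 * (b - a) = ∫ t in a..b, m ^ 2 := by simp; ring
    rw [this, ← intervalIntegral.integral_add (hi2.sub (hi.const_mul _)) intervalIntegrable_const]
    congr 1; ext t; ring
  have hm : m * (b - a) = h b - h a := div_mul_cancel₀ _ (sub_pos.2 hab).ne'
  rw [h1] at h0
  have := mul_nonneg (sub_pos.2 hab).le h0
  have e : (b - a) * ((∫ t in a..b, deriv h t ^ 2) - 2 * m * (h b - h a) + m ^ 2 * (b - a))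
    = (b - a) * (∫ t in a..b, deriv h t ^ 2) - 2 * (m * (b - a)) * (h b - h a)
      + (m * (b - a)) ^ 2 := by ring
  rw [e, hm] at this
  linarith

lemma lintegral_le_of_weak_decay {g : ℝ → ℝ} (hg : Measurable g) (hg0 : ∀ t, 0 ≤ g t) {C A : ℝ}
    (hC : 0 ≤ C) (hA : 0 ≤ A) (hgC : ∀ t, g t ≤ C)
    (hw : ∀ y, 0 < y → volume {t | y < g t} ≤ ENNReal.ofReal (A * y ^ (-(1 / 2) : ℝ))) :
    ∫⁻ t, ENNReal.ofReal (g t) ≤ ENNReal.ofReal (2 * A * √C) := by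
  rw [lintegral_eq_lintegral_meas_lt _ (ae_of_all _ hg0) hg.aemeasurable]
  calc ∫⁻ y in Ioi 0, volume {t | y < g t}
      ≤ ∫⁻ y in Ioi 0, (Ioc 0 C).indicator
          (fun y => ENNReal.ofReal (A * y ^ (-(1 / 2) : ℝ))) y := by
        refine setLIntegral_mono' measurableSet_Ioi fun y hy => ?_
        by_cases hyC : y ≤ C
        · rw [indicator_of_mem (show y ∈ Ioc 0 C from ⟨hy, hyC⟩)]
          exact hw y hy
        · have : {t | y < g t} = ∅ := by
            ext t
            simpa using (hgC t).trans (not_le.1 hyC).le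
          simp [this]
    _ ≤ ∫⁻ y, (Ioc 0 C).indicator
          (fun y => ENNReal.ofReal (A * y ^ (-(1 / 2) : ℝ))) y := setLIntegral_le_lintegral _ _
    _ = ∫⁻ y in Ioc 0 C, ENNReal.ofReal (A * y ^ (-(1 / 2) : ℝ)) :=
        lintegral_indicator measurableSet_Ioc _
    _ = ENNReal.ofReal (∫ y in Ioc 0 C, A * y ^ (-(1 / 2) : ℝ)) := by
        rw [ofReal_integral_eq_lintegral_ofReal]
        · have := (intervalIntegral.intervalIntegrable_rpow' (a := 0) (b := C)
            (r := -(1 / 2)) (by norm_num)).const_mul A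
          exact (intervalIntegrable_iff_integrableOn_Ioc_of_le hC).1 this
        · refine (ae_restrict_iff' measurableSet_Ioc).2 (ae_of_all _ fun y hy => ?_)
          exact mul_nonneg hA (Real.rpow_nonneg hy.1.le _)
    _ = ENNReal.ofReal (2 * A * √C) := by
        rw [← intervalIntegral.integral_of_le hC, intervalIntegral.integral_const_mul,
          integral_rpow (by norm_num)]
        congr 1
        rw [Real.sqrt_eq_rpow]
        norm_num
        ring

lemma exists_steep_point {C : ℝ≥0} {h : ℝ → ℝ} {ℓ K : ℝ} (hL : LipschitzWith C h) (hℓ : 0 < ℓ)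
    (h0 : ∀ t, ℓ ≤ |t| → h t = 0) (hne : h 0 ≠ 0) {Z : Set ℝ} (hZ : MeasurableSet Z)
    (hZtop : volume Z ≠ ⊤) (hZm : C * volume.real Z ≤ |h 0| / 8) (hK : 6400 * (C : ℝ) ^ 3 ≤ K) :
    ∃ τ, |τ| ≤ ℓ ∧ τ ∉ Z ∧ DifferentiableAt ℝ h τ ∧ |h 0| / (16 * ℓ) < deriv h τ ∧
      ∀ t, (h (τ + t) - h τ) ^ 4 ≤ K * deriv h τ * t ^ 4 := by
  by_contra! hcon
  set y0 := |h 0| / (16 * ℓ) with hy0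
  have hpos : 0 < |h 0| := abs_pos.2 hne
  have hy0pos : 0 < y0 := by positivity
  have hCpos : (0 : ℝ) < C := by
    have h1 := hL.dist_le_mul 0 ℓ
    rw [h0 ℓ (le_abs_self ℓ), Real.dist_eq, Real.dist_eq] at h1
    simp only [sub_zero] at h1
    by_contra hC0
    have : (C : ℝ) = 0 := le_antisymm (not_lt.1 hC0) C.2
    rw [this] at h1
    linarith
  have hKpos : 0 < K := lt_of_lt_of_le (by positivity) hK
  have hderiv0 : ∀ t, ℓ < |t| → deriv h t = 0 := by
    intro t ht
    have : h =ᶠ[𝓝 t] fun _ => 0 := by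
      filter_upwards [(isOpen_lt continuous_const continuous_abs).mem_nhds ht] with s hs
      exact h0 s (le_of_lt hs)
    rw [this.deriv_eq]; simp
  have hmeas := measurable_deriv h
  have hsupp : ∀ {φ : ℝ → ℝ}, (∀ t, deriv h t = 0 → φ t = 0) →
      Function.support φ ⊆ Ioc (-(ℓ + 1)) (ℓ + 1) := by
    intro φ hφ t ht
    by_contra hcon
    apply ht
    apply hφ
    apply hderiv0
    by_contra hle
    have := abs_le.1 (not_lt.1 hle)
    exact hcon ⟨by linarith, by linarith⟩
  have hint : ∀ {φ : ℝ → ℝ} (D : ℝ), Measurable φ → (∀ t, |φ t| ≤ D) →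
      (∀ t, deriv h t = 0 → φ t = 0) → Integrable φ := by
    intro φ D hm hb hφ
    rw [← integrableOn_iff_integrable_of_support_subset (hsupp hφ)]
    exact IntegrableOn.of_bound (by simp) hm.aestronglyMeasurable D
      (ae_of_all _ hb)
  have hi1 : Integrable (deriv h) := hint C hmeas hL.abs_deriv_le fun _ h => h
  have hip : Integrable fun t => max (deriv h t) 0 := by
    refine hint C (hmeas.max measurable_const) (fun t => ?_) (by simp +contextual)
    have := abs_le.1 (hL.abs_deriv_le t)
    rw [abs_of_nonneg (le_max_right _ _)]
    exact max_le this.2 hCpos.le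
  have hi2 : Integrable fun t => deriv h t ^ 2 := by
    refine hint ((C : ℝ) ^ 2) (hmeas.pow_const 2) (fun t => ?_) (by simp +contextual)
    rw [abs_pow]
    exact pow_le_pow_left₀ (abs_nonneg _) (hL.abs_deriv_le t) 2
  set P := ∫ t, max (deriv h t) 0 with hP
  set N := ∫ t, deriv h t ^ 2 with hN
  have hzero : ∫ t, deriv h t = 0 := by
    rw [← intervalIntegral.integral_eq_integral_of_support_subset (hsupp fun _ h => h),
      hL.intervalIntegral_deriv, h0, h0, sub_zero]
    · rw [abs_neg, abs_of_pos (by linarith)]; linarith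
    · rw [abs_of_pos (by linarith)]; linarith
  have hPnonneg : 0 ≤ P := integral_nonneg fun t => le_max_right _ _
  have hsub : ∀ a b, a ≤ b → ∫ t in a..b, deriv h t ≤ P := by
    intro a b hab
    calc ∫ t in a..b, deriv h t ≤ ∫ t in a..b, max (deriv h t) 0 :=
          intervalIntegral.integral_mono hab (hL.intervalIntegrable_deriv a b)
            hip.intervalIntegrable fun t => le_max_left _ _
      _ ≤ P := by
          rw [intervalIntegral.integral_of_le hab]
          exact setIntegral_le_integral hip (ae_of_all _ fun t => le_max_right _ _)
  have hPge : |h 0| ≤ P := by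
    rcases abs_cases (h 0) with h1 | h1
    · have := hsub (-ℓ) 0 (by linarith)
      rw [hL.intervalIntegral_deriv, h0 (-ℓ) (by rw [abs_neg]; exact le_abs_self _)] at this
      linarith
    · have := hsub 0 ℓ (by linarith)
      rw [hL.intervalIntegral_deriv, h0 ℓ (le_abs_self _)] at this
      linarith
  have hNle : N ≤ 2 * C * P := by
    have : ∫ t, deriv h t ^ 2 ≤ ∫ t, C * (2 * max (deriv h t) 0 - deriv h t) := by
      refine integral_mono hi2 (((hip.const_mul 2).sub hi1).const_mul _) fun t => ?_
      have h1 := hL.abs_deriv_le t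
      have h2 : 2 * max (deriv h t) 0 - deriv h t = |deriv h t| := by
        rcases le_total 0 (deriv h t) with h3 | h3
        · rw [max_eq_left h3, abs_of_nonneg h3]; ring
        · rw [max_eq_right h3, abs_of_nonpos h3]; ring
      simp only [h2]
      rw [← sq_abs, sq]
      exact mul_le_mul_of_nonneg_right h1 (abs_nonneg _)
    rw [integral_const_mul, integral_sub (hip.const_mul 2) hi1, integral_const_mul, hzero] at this
    linarith
  have hN0 : 0 ≤ N := integral_nonneg fun t => sq_nonneg _
  set G : Set ℝ := {t | y0 < deriv h t} \ Z with hG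
  have hGm : MeasurableSet G := (measurableSet_lt measurable_const hmeas).diff hZ
  set g : ℝ → ℝ := G.indicator (deriv h) with hg
  set ν : Measure ℝ := volume.withDensity fun t => ENNReal.ofReal (deriv h t ^ 2) with hν
  have hνuniv : ν univ = ENNReal.ofReal N := by
    rw [hν, withDensity_apply _ MeasurableSet.univ, Measure.restrict_univ,
      ← ofReal_integral_eq_lintegral_ofReal hi2 (ae_of_all _ fun t => sq_nonneg _)]
  have : IsFiniteMeasure ν := ⟨by rw [hνuniv]; exact ENNReal.ofReal_lt_top⟩
  have hνball : ∀ a b, a < b → ENNReal.ofReal ((h b - h a) ^ 2 / (b - a)) ≤ ν (Icc a b) := by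
    intro a b hab
    rw [hν, withDensity_apply _ measurableSet_Icc,
      ← ofReal_integral_eq_lintegral_ofReal hi2.integrableOn (ae_of_all _ fun t => sq_nonneg _)]
    apply ENNReal.ofReal_le_ofReal
    rw [div_le_iff₀' (sub_pos.2 hab), integral_Icc_eq_integral_Ioc,
      ← intervalIntegral.integral_of_le hab.le]
    exact hL.sq_sub_le_integral hab
  have hG_mem : ∀ t ∈ G, ∃ s, K * deriv h t * s ^ 4 < (h (t + s) - h t) ^ 4 := by
    intro t ht
    have ht1 : y0 < deriv h t := ht.1
    refine hcon t ?_ ht.2 ?_ ht1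
    · by_contra hlt
      have := hderiv0 t (not_le.1 hlt)
      linarith
    · by_contra hd
      have := deriv_zero_of_not_differentiableAt hd
      linarith
  have hweak : ∀ y, 0 < y →
      volume {t | y < g t} ≤ ENNReal.ofReal (10 * N / √K * y ^ (-(1 / 2) : ℝ)) := by
    intro y hy
    have hc : 0 < √(K * y) := Real.sqrt_pos.2 (by positivity)
    have key := weak_type_of_closedBall ν {t | y < g t} hc (fun τ hτ => by
      have hτ' : y < g τ := hτ
      have hτG : τ ∈ G := by
        by_contra hn
        rw [hg, indicator_of_notMem hn] at hτ'
        linarith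
      rw [hg, indicator_of_mem hτG] at hτ'
      obtain ⟨s, hs⟩ := hG_mem τ hτG
      have hs0 : s ≠ 0 := by rintro rfl; simp at hs
      refine ⟨|s|, abs_pos.2 hs0, ?_⟩
      have hs2 : √(K * y) * s ^ 2 < (h (τ + s) - h τ) ^ 2 := by
        refine lt_of_pow_lt_pow_left₀ 2 (sq_nonneg _) ?_
        calc (√(K * y) * s ^ 2) ^ 2 = K * y * s ^ 4 := by
              rw [mul_pow, Real.sq_sqrt (by positivity)]; ring
          _ ≤ K * deriv h τ * s ^ 4 := by gcongr
          _ < _ := by rw [← pow_mul]; exact hs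
      have hs3 : √(K * y) * |s| ≤ (h (τ + s) - h τ) ^ 2 / |s| := by
        rw [le_div_iff₀ (abs_pos.2 hs0), mul_assoc, abs_mul_abs_self, ← sq]
        exact hs2.le
      refine (ENNReal.ofReal_le_ofReal hs3).trans ?_
      rw [Real.closedBall_eq_Icc]
      rcases lt_or_gt_of_ne hs0 with hneg | hpos'
      · have := hνball (τ + s) τ (by linarith)
        rw [abs_of_neg hneg]
        refine (le_of_eq ?_).trans (this.trans (measure_mono (Icc_subset_Icc ?_ ?_)))
        · congr 1; rw [← neg_sub (h τ), neg_sq]; congr 1; ring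
        · linarith
        · linarith
      · have := hνball τ (τ + s) (by linarith)
        rw [abs_of_pos hpos']
        refine (le_of_eq ?_).trans (this.trans (measure_mono (Icc_subset_Icc ?_ ?_)))
        · congr 2; ring
        · linarith
        · linarith)
    rw [hνuniv] at key
    have e : 10 * N / √K * y ^ (-(1 / 2) : ℝ) = 10 * N / √(K * y) := by
      rw [Real.sqrt_mul hKpos.le, Real.rpow_neg hy.le, ← Real.sqrt_eq_rpow]
      field_simp
    rw [e, ENNReal.ofReal_div_of_pos hc, ENNReal.ofReal_mul (by norm_num),
      ENNReal.le_div_iff_mul_le (by simp [hc]) (by simp), mul_comm]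
    simpa using key
  have hgint : ∫⁻ t, ENNReal.ofReal (g t) ≤ ENNReal.ofReal (2 * (10 * N / √K) * √C) := by
    refine lintegral_le_of_weak_decay (hmeas.indicator hGm) (fun t => ?_) hCpos.le
      (by positivity) (fun t => ?_) hweak
    · refine indicator_nonneg (fun t ht => ?_) t
      exact hy0pos.le.trans (le_of_lt ht.1)
    · by_cases ht : t ∈ G
      · rw [indicator_of_mem ht]
        exact (abs_le.1 (hL.abs_deriv_le t)).2
      · rw [indicator_of_notMem ht]; exact hCpos.le
  have hbound : ENNReal.ofReal P ≤ ENNReal.ofReal (C * volume.real Z) +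
      ENNReal.ofReal (y0 * (2 * ℓ)) + ENNReal.ofReal (2 * (10 * N / √K) * √C) := by
    rw [hP, ofReal_integral_eq_lintegral_ofReal hip (ae_of_all _ fun t => le_max_right _ _)]
    calc ∫⁻ t, ENNReal.ofReal (max (deriv h t) 0)
        ≤ ∫⁻ t, (Z.indicator (fun _ => ENNReal.ofReal C) t +
            (Icc (-ℓ) ℓ).indicator (fun _ => ENNReal.ofReal y0) t + ENNReal.ofReal (g t)) := by
          refine lintegral_mono fun t => ?_
          by_cases htZ : t ∈ Z
          · rw [indicator_of_mem htZ, add_assoc]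
            refine le_add_right (ENNReal.ofReal_le_ofReal ?_)
            exact max_le (abs_le.1 (hL.abs_deriv_le t)).2 hCpos.le
          · by_cases hty : y0 < deriv h t
            · refine le_add_left ?_
              rw [hg, indicator_of_mem (show t ∈ G from ⟨hty, htZ⟩),
                max_eq_left (hy0pos.le.trans hty.le)]
            · by_cases htl : t ∈ Icc (-ℓ) ℓ
              · rw [indicator_of_mem htl, add_right_comm]
                refine le_add_left (ENNReal.ofReal_le_ofReal ?_)
                exact max_le (not_lt.1 hty) hy0pos.le
              · rw [hderiv0 t (by
                  by_contra hle
                  exact htl (abs_le.1 (not_lt.1 hle)))]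
                simp
      _ = ENNReal.ofReal C * volume Z + ENNReal.ofReal y0 * volume (Icc (-ℓ) ℓ)
            + ∫⁻ t, ENNReal.ofReal (g t) := by
          rw [lintegral_add_left, lintegral_add_left, lintegral_indicator hZ,
            lintegral_indicator measurableSet_Icc]
          · simp
          · exact measurable_const.indicator hZ
          · exact (measurable_const.indicator hZ).add (measurable_const.indicator measurableSet_Icc)
      _ ≤ _ := by
          rw [ENNReal.ofReal_mul hCpos.le, ENNReal.ofReal_mul hy0pos.le, Real.volume_Icc,
            Measure.real, ENNReal.ofReal_toReal hZtop]
          gcongr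
          linarith
  rw [← ENNReal.ofReal_add (by positivity) (by positivity),
    ← ENNReal.ofReal_add (by positivity) (by positivity),
    ENNReal.ofReal_le_ofReal_iff (by positivity)] at hbound
  have hy0l : y0 * (2 * ℓ) = |h 0| / 8 := by rw [hy0]; field_simp; norm_num
  have hlast : 2 * (10 * N / √K) * √C ≤ P / 2 := by
    have h1 : 80 * C * √C ≤ √K := by
      apply Real.le_sqrt_of_sq_le
      rw [mul_pow, Real.sq_sqrt hCpos.le]
      calc (80 * (C : ℝ)) ^ 2 * C = 6400 * (C : ℝ) ^ 3 := by ring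
        _ ≤ K := hK
    have hsK : 0 < √K := Real.sqrt_pos.2 hKpos
    rw [show 2 * (10 * N / √K) * √C = (20 * N * √C) / √K by ring, div_le_iff₀ hsK]
    calc 20 * N * √C ≤ 20 * (2 * C * P) * √C := by gcongr
      _ = P / 2 * (80 * C * √C) := by ring
      _ ≤ P / 2 * √K := by gcongr
  linarith

variable {E : Type*} [NormedAddCommGroup E] [InnerProductSpace ℝ E]

lemma min_max_zero_sub (t t' : ℝ) :
    |min t 0 - min t' 0| + |max t 0 - max t' 0| = |t - t'| := by
  rcases le_total t 0 with h | h <;> rcases le_total t' 0 with h' | h' <;>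
    simp only [min_eq_left, min_eq_right, max_eq_left, max_eq_right, h, h', sub_self, abs_zero,
      add_zero, zero_add, sub_zero, zero_sub, abs_neg]
  · rw [abs_of_nonpos h, abs_of_nonneg h', abs_of_nonpos (by linarith)]; ring
  · rw [abs_of_nonneg h, abs_of_nonpos h', abs_of_nonneg (by linarith)]; ring

lemma add_pow_four_le (v w : ℝ) : (v + w) ^ 4 ≤ 8 * (v ^ 4 + w ^ 4) := by
  nlinarith [sq_nonneg (v - w), sq_nonneg (v ^ 2 - w ^ 2), sq_nonneg (v + w),
    mul_nonneg (sq_nonneg (v - w)) (sq_nonneg (v + w)),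
    mul_nonneg (sq_nonneg (v - w)) (sq_nonneg v), mul_nonneg (sq_nonneg (v - w)) (sq_nonneg w),
    sq_nonneg ((v - w)^2)]

lemma pow_four_le_of_abs_le {X v w A B : ℝ} (h : |X| ≤ |v| + w) (hv : v ^ 4 ≤ A)
    (hw : w ^ 4 ≤ B) : X ^ 4 ≤ 8 * (A + B) := by
  have h4 : ∀ a : ℝ, |a| ^ 4 = a ^ 4 := fun a => (show Even 4 by decide).pow_abs a
  calc X ^ 4 = |X| ^ 4 := (h4 X).symm
    _ ≤ (|v| + w) ^ 4 := by gcongr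
    _ ≤ 8 * (|v| ^ 4 + w ^ 4) := add_pow_four_le _ _
    _ ≤ 8 * (A + B) := by rw [h4]; gcongr

/-- The constant in the increment estimate along a wedge. -/
noncomputable def wedgeConst : ℝ := 16 * (6400 * 60 ^ 3 + 1)

set_option maxHeartbeats 1600000 in
lemma exists_steep_point_on_wedge {φ : E → ℝ} (hφ : LipschitzWith 9 φ) {x e u : E} {c σ ℓ : ℝ}
    (hc : |c| ≤ 18) (he : ‖e‖ ≤ 2) (hσ : 0 < σ) (hσ' : σ ≤ 1 / 500) (hℓ : 0 < ℓ)
    (hu : ‖u‖ = σ * ℓ) (hφu : 500 * σ ^ 2 * ℓ < |φ (x + u) - φ x|)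
    (hη : ∀ t, |t| * σ ≤ 6 * ℓ → |φ (x + t • e) - φ x - c * t| ≤ σ ^ 4 / 100 * |t|)
    {a₁ a₂ a₃ : E} (h₁ : ‖a₁ - (x - ℓ • e)‖ ≤ σ ^ 5 / 100 * ℓ)
    (h₂ : ‖a₂ - (x + u)‖ ≤ σ ^ 5 / 100 * ℓ) (h₃ : ‖a₃ - (x + ℓ • e)‖ ≤ σ ^ 5 / 100 * ℓ) :
    ∃ x' ∈ segment ℝ a₁ a₂ ∪ segment ℝ a₂ a₃, ∃ e' D, ‖x' - x‖ ≤ 5 * ℓ ∧ ‖e' - e‖ ≤ 1 ∧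
      HasLineDerivAt ℝ φ D x' e' ∧ 12 * σ ^ 2 ≤ D - c - 2 * ‖e' - e‖ ^ 2 ∧
      ∀ t : ℝ, (φ (x' + t • e) - φ x' - (φ (x + t • e) - φ x)) ^ 4 ≤
        wedgeConst * (D - c - 2 * ‖e' - e‖ ^ 2) * t ^ 4 := by
  have hφ' : ∀ a b, |φ a - φ b| ≤ 9 * ‖a - b‖ := fun a b => by
    have := hφ.dist_le_mul a b
    rwa [Real.dist_eq, dist_eq_norm] at this
  have hσ2 : σ ^ 2 ≤ 1 / 250000 := by nlinarith
  have hσ3 : σ ^ 3 ≤ σ ^ 2 / 500 := by nlinarith [sq_nonneg σ]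
  have hσ4 : σ ^ 4 ≤ σ ^ 3 / 500 := by nlinarith [pow_pos hσ 3]
  have hσ5 : σ ^ 5 ≤ σ ^ 4 / 500 := by nlinarith [pow_pos hσ 4]
  have hσ1 : σ ^ 2 ≤ σ / 500 := by nlinarith
  have p2 := pow_pos hσ 2
  have p3 := pow_pos hσ 3
  have p4 := pow_pos hσ 4
  have p5 := pow_pos hσ 5
  have q5 := mul_le_mul_of_nonneg_right hσ5 hℓ.le
  have q4 := mul_le_mul_of_nonneg_right hσ4 hℓ.le
  have q3 := mul_le_mul_of_nonneg_right hσ3 hℓ.le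
  have q2 := mul_le_mul_of_nonneg_right hσ1 hℓ.le
  have q1 := mul_le_mul_of_nonneg_right hσ' hℓ.le
  have r1 := mul_pos hσ hℓ
  have r2 := mul_pos p2 hℓ
  have r3 := mul_pos p3 hℓ
  have r4 := mul_pos p4 hℓ
  have r5 := mul_pos p5 hℓ
  set p : E := ℓ⁻¹ • (a₂ - a₁) - e with hp
  set q : E := ℓ⁻¹ • (a₃ - a₂) - e with hq
  have hpl : ℓ • (e + p) = a₂ - a₁ := by
    rw [hp, add_sub_cancel, smul_smul, mul_inv_cancel₀ hℓ.ne', one_smul]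
  have hql : ℓ • (e + q) = a₃ - a₂ := by
    rw [hq, add_sub_cancel, smul_smul, mul_inv_cancel₀ hℓ.ne', one_smul]
  have aux : ∀ w w₁ w₂ : E, ‖w₁‖ ≤ σ ^ 5 / 100 * ℓ → ‖w₂‖ ≤ σ ^ 5 / 100 * ℓ →
      (ℓ • w = w₁ - w₂ + u ∨ ℓ • w = w₁ - w₂ - u) → ‖w‖ ≤ 2 * σ := by
    intro w w₁ w₂ hw₁ hw₂ hw
    have h1 : ‖ℓ • w‖ ≤ ‖w₁‖ + ‖w₂‖ + ‖u‖ := by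
      rcases hw with hw | hw <;> rw [hw]
      · exact (norm_add_le _ _).trans (by gcongr; exact norm_sub_le _ _)
      · exact (norm_sub_le _ _).trans (by gcongr; exact norm_sub_le _ _)
    rw [norm_smul, Real.norm_of_nonneg hℓ.le, hu] at h1
    have h2 : ℓ * ‖w‖ ≤ ℓ * (2 * σ) := by linarith
    exact le_of_mul_le_mul_left h2 hℓ
  have hpn : ‖p‖ ≤ 2 * σ := by
    refine aux p _ _ h₂ h₁ (Or.inl ?_)
    have : ℓ • p = ℓ • (e + p) - ℓ • e := by rw [smul_add]; abel
    rw [this, hpl]; abel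
  have hqn : ‖q‖ ≤ 2 * σ := by
    refine aux q _ _ h₃ h₂ (Or.inr ?_)
    have : ℓ • q = ℓ • (e + q) - ℓ • e := by rw [smul_add]; abel
    rw [this, hql]; abel
  set v : ℝ → E := fun t => min t 0 • p + max t 0 • q with hv
  have hvL : ∀ t t', ‖v t - v t'‖ ≤ 2 * σ * |t - t'| := by
    intro t t'
    have : v t - v t' = (min t 0 - min t' 0) • p + (max t 0 - max t' 0) • q := by
      simp only [hv, sub_smul]; abel
    rw [this, ← min_max_zero_sub t t']
    refine (norm_add_le _ _).trans ?_
    rw [norm_smul, norm_smul, Real.norm_eq_abs, Real.norm_eq_abs, mul_add,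
      mul_comm |_|, mul_comm |max t 0 - _|]
    gcongr
  have hv0 : v 0 = 0 := by simp [hv]
  set γ : ℝ → E := fun t => a₂ + t • e + v t with hγ
  have hγL : ∀ t t', ‖γ t - γ t'‖ ≤ 3 * |t - t'| := by
    intro t t'
    have : γ t - γ t' = (t - t') • e + (v t - v t') := by
      simp only [hγ, sub_smul]; abel
    rw [this]
    refine (norm_add_le _ _).trans ?_
    rw [norm_smul, Real.norm_eq_abs]
    have h1 := mul_le_mul_of_nonneg_left he (abs_nonneg (t - t'))
    have h2 := mul_le_mul_of_nonneg_right hσ' (abs_nonneg (t - t'))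
    linarith [hvL t t', abs_nonneg (t - t')]
  have hγ0 : γ 0 = a₂ := by simp [hγ, hv0]
  have hγneg : ∀ t ≤ 0, γ t = a₂ + t • (e + p) := by
    intro t ht
    simp only [hγ, hv, min_eq_left ht, max_eq_right ht, zero_smul, add_zero, smul_add]; abel
  have hγpos : ∀ t, 0 ≤ t → γ t = a₂ + t • (e + q) := by
    intro t ht
    simp only [hγ, hv, min_eq_right ht, max_eq_left ht, zero_smul, zero_add, smul_add]; abel
  have hγl : γ ℓ = a₃ := by rw [hγpos ℓ hℓ.le, hql]; abel
  have hγl' : γ (-ℓ) = a₁ := by rw [hγneg _ (by linarith), neg_smul, hpl]; abel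
  have hℓσ : ℓ * σ ≤ 6 * ℓ := by linarith
  set h₀ : ℝ → ℝ := fun t => φ (γ t) - φ x - c * t with hh₀
  have hh₀L : ∀ t t', |h₀ t - h₀ t'| ≤ 45 * |t - t'| := by
    intro t t'
    have e1 : h₀ t - h₀ t' = (φ (γ t) - φ (γ t')) - c * (t - t') := by simp only [hh₀]; ring
    have := hφ' (γ t) (γ t')
    have h2 := hγL t t'
    have h3 : |c * (t - t')| ≤ 18 * |t - t'| := by rw [abs_mul]; gcongr
    rw [e1]
    refine (abs_sub _ _).trans ?_
    linarith
  set B := σ ^ 4 / 50 * ℓ with hB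
  have hBpos : 0 < B := by positivity
  have h9 : 9 * (σ ^ 5 / 100 * ℓ) ≤ B / 2 := by rw [hB]; linarith
  have hend₁ : |h₀ ℓ| ≤ B := by
    have e1 : h₀ ℓ = (φ a₃ - φ (x + ℓ • e)) + (φ (x + ℓ • e) - φ x - c * ℓ) := by
      simp only [hh₀, hγl]; ring
    rw [e1]
    refine (abs_add_le _ _).trans ?_
    have h1 := hφ' a₃ (x + ℓ • e)
    have h2 := hη ℓ (by rw [abs_of_pos hℓ]; exact hℓσ)
    rw [abs_of_pos hℓ] at h2
    linarith
  have hend₂ : |h₀ (-ℓ)| ≤ B := by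
    have e1 : h₀ (-ℓ) = (φ a₁ - φ (x - ℓ • e)) + (φ (x + (-ℓ) • e) - φ x - c * (-ℓ)) := by
      simp only [hh₀, hγl', neg_smul, ← sub_eq_add_neg]; ring
    rw [e1]
    refine (abs_add_le _ _).trans ?_
    have h1 := hφ' a₁ (x - ℓ • e)
    have h2 := hη (-ℓ) (by rw [abs_neg, abs_of_pos hℓ]; exact hℓσ)
    rw [abs_neg, abs_of_pos hℓ] at h2
    linarith
  set α := (h₀ ℓ + h₀ (-ℓ)) / 2 with hα
  set β := (h₀ ℓ - h₀ (-ℓ)) / (2 * ℓ) with hβ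
  have hαβ : α + β * ℓ = h₀ ℓ := by rw [hα, hβ]; field_simp; ring
  have hαβ' : α + β * (-ℓ) = h₀ (-ℓ) := by rw [hα, hβ]; field_simp; ring
  have hαn : |α| ≤ B := by
    rw [hα, abs_div, abs_two]
    have := abs_add_le (h₀ ℓ) (h₀ (-ℓ)); linarith
  have hβn : |β| ≤ σ ^ 4 / 50 := by
    rw [hβ, abs_div, abs_of_pos (show 0 < 2 * ℓ by positivity), div_le_iff₀ (by positivity)]
    have := abs_sub (h₀ ℓ) (h₀ (-ℓ)); linarith
  have hlin : ∀ t, |t| ≤ ℓ → |α + β * t| ≤ B := by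
    intro t ht
    have ⟨ht1, ht2⟩ := abs_le.1 ht
    have e1 : α + β * t = ((ℓ + t) * h₀ ℓ + (ℓ - t) * h₀ (-ℓ)) / (2 * ℓ) := by
      rw [hα, hβ]; field_simp; ring
    rw [e1, abs_div, abs_of_pos (show 0 < 2 * ℓ by positivity), div_le_iff₀ (by positivity)]
    refine (abs_add_le _ _).trans ?_
    rw [abs_mul, abs_mul, abs_of_nonneg (show 0 ≤ ℓ + t by linarith),
      abs_of_nonneg (show 0 ≤ ℓ - t by linarith)]
    have h1 := mul_le_mul_of_nonneg_left hend₁ (show 0 ≤ ℓ + t by linarith)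
    have h2 := mul_le_mul_of_nonneg_left hend₂ (show 0 ≤ ℓ - t by linarith)
    linarith
  set cl : ℝ → ℝ := fun t => max (-ℓ) (min t ℓ) with hcl
  have hclL : ∀ t t', |cl t - cl t'| ≤ |t - t'| := by
    intro t t'
    calc |cl t - cl t'| ≤ |min t ℓ - min t' ℓ| := by
          have := abs_max_sub_max_le_max (-ℓ) (min t ℓ) (-ℓ) (min t' ℓ)
          simpa [hcl] using this
      _ ≤ |t - t'| := by
          have := abs_min_sub_min_le_max t ℓ t' ℓ
          simpa using this
  have hclid : ∀ t, |t| ≤ ℓ → cl t = t := by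
    intro t ht
    have ⟨ht1, ht2⟩ := abs_le.1 ht
    simp only [hcl, min_eq_left ht2, max_eq_right ht1]
  set h : ℝ → ℝ := fun t => h₀ (cl t) - (α + β * cl t) with hh
  have hhL : LipschitzWith 60 h := by
    refine LipschitzWith.of_dist_le_mul fun t t' => ?_
    rw [Real.dist_eq, Real.dist_eq]
    have e1 : h t - h t' = (h₀ (cl t) - h₀ (cl t')) - β * (cl t - cl t') := by
      simp only [hh]; ring
    have h1 := hh₀L (cl t) (cl t')
    have h2 := hclL t t'
    have h3 : |β * (cl t - cl t')| ≤ 1 * |cl t - cl t'| := by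
      rw [abs_mul]; gcongr; linarith
    rw [e1]
    refine (abs_sub _ _).trans ?_
    rw [show ((60 : ℝ≥0) : ℝ) = 60 by norm_num]
    linarith [abs_nonneg (t - t')]
  have hh_eq : ∀ t, |t| ≤ ℓ → h t = φ (γ t) - φ x - c * t - (α + β * t) := by
    intro t ht
    simp only [hh, hclid t ht, hh₀]
  have hhzero : ∀ t, ℓ ≤ |t| → h t = 0 := by
    intro t ht
    rcases le_abs.1 ht with ht | ht
    · have : cl t = ℓ := by simp only [hcl, min_eq_right ht]; exact max_eq_right (by linarith)
      simp only [hh, this, hαβ, sub_self]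
    · have : cl t = -ℓ := by
        simp only [hcl]; rw [min_eq_left (by linarith)]; exact max_eq_left (by linarith)
      simp only [hh, this, hαβ', sub_self]
  have hh0 : 499 * σ ^ 2 * ℓ ≤ |h 0| := by
    have e1 : φ (x + u) - φ x = h 0 + α - (φ a₂ - φ (x + u)) := by
      rw [hh_eq 0 (by simpa using hℓ.le), hγ0]; ring
    have h1 := hφ' a₂ (x + u)
    have h2 : |φ (x + u) - φ x| ≤ |h 0| + |α| + |φ a₂ - φ (x + u)| := by
      rw [e1]
      exact (abs_sub _ _).trans (by gcongr; exact abs_add_le _ _)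
    have h3 : B * 2 ≤ σ ^ 2 * ℓ := by rw [hB]; linarith
    linarith
  have hh0pos : 0 < |h 0| := lt_of_lt_of_le (by positivity) hh0
  set m := σ ^ 2 * ℓ / 4 with hm
  have hmpos : 0 < m := by positivity
  set Z : Set ℝ := {0} ∪ Icc (-ℓ) (-ℓ + m) ∪ Icc (ℓ - m) ℓ with hZ
  have hZvol : volume Z ≤ ENNReal.ofReal (2 * m) := by
    calc volume Z ≤ volume ({0} : Set ℝ) + volume (Icc (-ℓ) (-ℓ + m)) + volume (Icc (ℓ - m) ℓ) :=
          (measure_union_le _ _).trans (by gcongr; exact measure_union_le _ _)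
      _ = ENNReal.ofReal (2 * m) := by
          rw [Real.volume_singleton, Real.volume_Icc, Real.volume_Icc, zero_add,
            ← ENNReal.ofReal_add (by linarith) (by linarith)]
          congr 1; ring
  obtain ⟨τ, hτℓ, hτZ, hτd, hτy, hτK⟩ := exists_steep_point (K := 6400 * 60 ^ 3) hhL hℓ hhzero
    (abs_pos.1 hh0pos) (Z := Z)
    (((measurableSet_singleton _).union measurableSet_Icc).union measurableSet_Icc)
    (ne_top_of_le_ne_top ENNReal.ofReal_ne_top hZvol) (by
      have : volume.real Z ≤ 2 * m := by
        rw [Measure.real]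
        exact ENNReal.toReal_le_of_le_ofReal (by positivity) hZvol
      rw [show ((60 : ℝ≥0) : ℝ) = 60 by norm_num]
      rw [hm] at this
      linarith [mul_pos p2 hℓ]) (by norm_num)
  set y := deriv h τ with hy
  have hτ0 : τ ≠ 0 := fun h0 => hτZ (Or.inl (Or.inl h0))
  have ⟨hτ1, hτ2⟩ := abs_le.1 hτℓ
  have hτm1 : -ℓ + m < τ := by
    by_contra hcon
    exact hτZ (Or.inl (Or.inr ⟨hτ1, not_lt.1 hcon⟩))
  have hτm2 : τ < ℓ - m := by
    by_contra hcon
    exact hτZ (Or.inr ⟨not_lt.1 hcon, hτ2⟩)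
  have hy31 : 31 * σ ^ 2 ≤ y := by
    refine le_trans ?_ hτy.le
    rw [le_div_iff₀ (by positivity)]
    linarith [mul_pos p2 hℓ]
  have hxx : ‖γ τ - x‖ ≤ 5 * ℓ := by
    have e1 : γ τ - x = (γ τ - γ 0) + (a₂ - (x + u)) + u := by rw [hγ0]; abel
    have h1 := hγL τ 0
    rw [sub_zero] at h1
    have h2 : ‖γ τ - x‖ ≤ ‖γ τ - γ 0‖ + ‖a₂ - (x + u)‖ + ‖u‖ := by
      rw [e1]; exact norm_add₃_le
    rw [hu] at h2
    linarith
  obtain ⟨w, hw, hxmem, hloc⟩ : ∃ w : E, ‖w‖ ≤ 2 * σ ∧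
      γ τ ∈ segment ℝ a₁ a₂ ∪ segment ℝ a₂ a₃ ∧
      ∀ᶠ t in 𝓝 (0 : ℝ), γ (τ + t) = γ τ + t • (e + w) := by
    rcases lt_or_gt_of_ne hτ0 with hneg | hpos
    · refine ⟨p, hpn, Or.inl ?_, ?_⟩
      · refine ⟨-τ / ℓ, 1 + τ / ℓ, div_nonneg (by linarith) hℓ.le, ?_, by ring, ?_⟩
        · have : -1 ≤ τ / ℓ := by rw [le_div_iff₀ hℓ]; linarith
          linarith
        · rw [hγneg τ hneg.le]
          have : τ • (e + p) = (τ / ℓ) • (a₂ - a₁) := by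
            rw [← hpl, smul_smul, div_mul_cancel₀ _ hℓ.ne']
          rw [this, add_smul, one_smul, smul_sub, neg_div, neg_smul]; abel
      · filter_upwards [eventually_lt_nhds (show (0 : ℝ) < -τ by linarith)] with t ht
        rw [hγneg _ (by linarith), hγneg _ hneg.le, add_smul]; abel
    · refine ⟨q, hqn, Or.inr ?_, ?_⟩
      · refine ⟨1 - τ / ℓ, τ / ℓ, ?_, div_nonneg (by linarith) hℓ.le, by ring, ?_⟩
        · have : τ / ℓ ≤ 1 := by rw [div_le_iff₀ hℓ]; linarith
          linarith
        · rw [hγpos τ (le_of_lt hpos)]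
          have : τ • (e + q) = (τ / ℓ) • (a₃ - a₂) := by
            rw [← hql, smul_smul, div_mul_cancel₀ _ hℓ.ne']
          rw [this, sub_smul, one_smul, smul_sub]; abel
      · filter_upwards [eventually_gt_nhds (show -τ < (0 : ℝ) by linarith)] with t ht
        rw [hγpos _ (by linarith), hγpos _ (le_of_lt hpos), add_smul]; abel
  have hline : HasLineDerivAt ℝ φ (y + c + β) (γ τ) (e + w) := by
    have h1 : HasDerivAt (fun t => h (τ + t) + (φ x + α + (c + β) * (τ + t))) (y + (c + β)) 0 := by
      refine HasDerivAt.add ?_ ?_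
      · have := hτd.hasDerivAt
        exact HasDerivAt.comp_const_add τ 0 (by rw [add_zero]; exact this)
      · simpa using ((((hasDerivAt_id (0 : ℝ)).const_add τ).const_mul (c + β)).const_add (φ x + α))
    rw [← add_assoc] at h1
    refine h1.congr_of_eventuallyEq ?_
    have hnear : ∀ᶠ t in 𝓝 (0 : ℝ), |τ + t| ≤ ℓ := by
      have : ∀ᶠ t in 𝓝 (0 : ℝ), |τ + t| < ℓ := by
        refine (continuous_const.add continuous_id).abs.continuousAt.eventually_lt_const ?_
        change |τ + 0| < ℓ
        rw [add_zero]
        exact abs_lt.2 ⟨by linarith, by linarith⟩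
      exact this.mono fun t => le_of_lt
    filter_upwards [hloc, hnear] with t ht1 ht2
    rw [hh_eq _ ht2, ht1]; ring
  have hY : y / 2 ≤ y + c + β - c - 2 * ‖e + w - e‖ ^ 2 := by
    rw [add_sub_cancel_left]
    have h1 : ‖w‖ ^ 2 ≤ (2 * σ) ^ 2 := by gcongr
    have h2 := neg_abs_le β
    rw [mul_pow] at h1
    linarith
  refine ⟨γ τ, hxmem, e + w, y + c + β, hxx, ?_, hline, ?_, ?_⟩
  · rw [add_sub_cancel_left]; linarith
  · linarith
  intro t
  set X := φ (γ τ + t • e) - φ (γ τ) - (φ (x + t • e) - φ x) with hX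
  have key : |X| ≤ |h (τ + t) - h τ| + 20 * σ * |t| := by
    rcases le_or_gt (|t| * σ) (5 * ℓ) with ht | ht
    · have hηt := hη t (by linarith)
      have htn := abs_nonneg t
      rcases le_or_gt |τ + t| ℓ with htτ | htτ
      · have e1 : X = (h (τ + t) - h τ) + β * t - (φ (γ (τ + t)) - φ (γ τ + t • e))
            - (φ (x + t • e) - φ x - c * t) := by
          rw [hh_eq _ htτ, hh_eq _ hτℓ, hX]; ring
        have h1 := hφ' (γ (τ + t)) (γ τ + t • e)
        have h2 : γ (τ + t) - (γ τ + t • e) = v (τ + t) - v τ := by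
          simp only [hγ, add_smul]; abel
        have h3 := hvL (τ + t) τ
        rw [add_sub_cancel_left] at h3
        rw [h2] at h1
        have h4 : |β * t| ≤ σ ^ 4 / 50 * |t| := by rw [abs_mul]; gcongr
        have h5 : |X| ≤ |h (τ + t) - h τ| + |β * t| + |φ (γ (τ + t)) - φ (γ τ + t • e)|
            + |φ (x + t • e) - φ x - c * t| := by
          rw [e1]
          exact (abs_sub _ _).trans (by
            gcongr; exact (abs_sub _ _).trans (by gcongr; exact abs_add_le _ _))
        have h6 := mul_le_mul_of_nonneg_right (show σ ^ 4 ≤ σ by linarith) htn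
        linarith [mul_nonneg hσ.le htn]
      · have hmt : m ≤ |t| := by
          have := abs_add_le τ t
          have hτab : |τ| ≤ ℓ - m := abs_le.2 ⟨by linarith, by linarith⟩
          linarith
        obtain ⟨b, hbab, hbt, hbn⟩ : ∃ b, |b| = ℓ ∧ |b - τ| ≤ |t| ∧
            ‖γ b - (x + b • e)‖ ≤ σ ^ 5 / 100 * ℓ := by
          rcases lt_abs.1 htτ with h1 | h1
          · refine ⟨ℓ, abs_of_pos hℓ, ?_, by rw [hγl]; exact h₃⟩
            rw [abs_of_nonneg (by linarith)]
            exact le_trans (by linarith) (le_abs_self t)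
          · refine ⟨-ℓ, by rw [abs_neg, abs_of_pos hℓ], ?_, ?_⟩
            · rw [abs_of_nonpos (by linarith)]
              exact le_trans (by linarith) (neg_le_abs t)
            · rw [hγl', neg_smul, ← sub_eq_add_neg]; exact h₁
        have hηt' := hη (τ + t) (by
          have h1 := mul_le_mul_of_nonneg_right (abs_add_le τ t) hσ.le
          have h2 := mul_le_mul_of_nonneg_right hτℓ hσ.le
          linarith)
        have htt : |τ + t| ≤ ℓ + |t| := (abs_add_le _ _).trans (by linarith)
        have e1 : X = (h (τ + t) - h τ) - (α + β * τ) +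
            (φ (γ τ + t • e) - φ (x + (τ + t) • e))
            + (φ (x + (τ + t) • e) - φ x - c * (τ + t)) - (φ (x + t • e) - φ x - c * t) := by
          rw [hhzero _ htτ.le, hh_eq _ hτℓ, hX]; ring
        have e2 : γ τ + t • e - (x + (τ + t) • e) = (v τ - v b) + (γ b - (x + b • e)) := by
          simp only [hγ, add_smul]; abel
        have h1 := hφ' (γ τ + t • e) (x + (τ + t) • e)
        have h2 : ‖γ τ + t • e - (x + (τ + t) • e)‖ ≤ 2 * σ * |t| + σ ^ 5 / 100 * ℓ := by
          rw [e2]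
          refine (norm_add_le _ _).trans (add_le_add ((hvL _ _).trans ?_) hbn)
          rw [abs_sub_comm]; gcongr
        have h4 := hlin τ hτℓ
        have h5 : |X| ≤ |h (τ + t) - h τ| + |α + β * τ|
            + |φ (γ τ + t • e) - φ (x + (τ + t) • e)|
            + |φ (x + (τ + t) • e) - φ x - c * (τ + t)| + |φ (x + t • e) - φ x - c * t| := by
          rw [e1]
          exact (abs_sub _ _).trans (by
            gcongr
            exact (abs_add_le _ _).trans (by
              gcongr; exact (abs_add_le _ _).trans (by gcongr; exact abs_sub _ _)))
        have h6 : σ ^ 4 / 100 * |t| ≤ σ ^ 3 / 20 * ℓ := by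
          have := mul_le_mul_of_nonneg_left ht p3.le
          linarith
        have h7 : σ ^ 4 / 100 * |τ + t| ≤ σ ^ 4 / 100 * ℓ + σ ^ 4 / 100 * |t| := by
          rw [← mul_add]; gcongr
        have h8 : σ ^ 3 * ℓ / 4 ≤ σ * |t| := by
          have : σ * m ≤ σ * |t| := by gcongr
          rw [hm] at this
          linarith
        rw [hB] at h4 h9
        linarith
    · have e1 : X = (φ (γ τ + t • e) - φ (x + t • e)) - (φ (γ τ) - φ x) := by rw [hX]; ring
      have h1 := hφ' (γ τ + t • e) (x + t • e)
      have h2 := hφ' (γ τ) x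
      rw [add_sub_add_right_eq_sub] at h1
      have h3 := (congrArg abs e1).le.trans (abs_sub _ _)
      have := abs_nonneg (h (τ + t) - h τ)
      linarith
  have hv4 := hτK t
  have hw4 : (20 * σ * |t|) ^ 4 ≤ y * t ^ 4 := by
    have e1 : (20 * σ * |t|) ^ 4 = 160000 * σ ^ 4 * t ^ 4 := by
      rw [mul_pow, show |t| ^ 4 = (|t| ^ 2) ^ 2 by ring, sq_abs]; ring
    rw [e1]
    have : 160000 * σ ^ 4 ≤ y := by linarith
    gcongr
  refine (pow_four_le_of_abs_le key hv4 hw4).trans ?_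
  rw [← add_mul, ← add_one_mul, ← mul_assoc, ← mul_assoc]
  refine mul_le_mul_of_nonneg_right ?_ (by positivity)
  rw [show (8 : ℝ) * (6400 * 60 ^ 3 + 1) * y = wedgeConst * (y / 2) by rw [wedgeConst]; ring]
  exact mul_le_mul_of_nonneg_left hY (by rw [wedgeConst]; norm_num)

/-- Near `x`, every two-segment polygonal line can be approximated by one contained in `S`, with an
error small compared to its distance from `x`. -/
def HasWedges (x : E) (S : Set E) : Prop :=
  ∀ η : ℝ, 0 < η → ∃ ρ₀ : ℝ, 0 < ρ₀ ∧ ∀ ρ : ℝ, 0 < ρ → ρ < ρ₀ → ∀ y₁ y₂ y₃ : E,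
    ‖y₁ - x‖ ≤ ρ → ‖y₂ - x‖ ≤ ρ → ‖y₃ - x‖ ≤ ρ → ∃ a₁ a₂ a₃ : E,
      ‖a₁ - y₁‖ ≤ η * ρ ∧ ‖a₂ - y₂‖ ≤ η * ρ ∧ ‖a₃ - y₃‖ ≤ η * ρ ∧
      segment ℝ a₁ a₂ ⊆ S ∧ segment ℝ a₂ a₃ ⊆ S

lemma exists_increase_of_not_hasFDerivAt_zero {φ : E → ℝ} (hφ : LipschitzWith 9 φ) {x e : E}
    {c : ℝ} (hc : |c| ≤ 18) (he : ‖e‖ ≤ 2) (hd : HasLineDerivAt ℝ φ c x e)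
    (hnd : ¬ HasFDerivAt φ (0 : E →L[ℝ] ℝ) x) :
    ∃ y₀ : ℝ, 0 < y₀ ∧ ∀ S, HasWedges x S → ∀ ρ > 0, ∃ x' ∈ S, ∃ e' D, ‖x' - x‖ < ρ ∧
      ‖e' - e‖ ≤ 1 ∧ HasLineDerivAt ℝ φ D x' e' ∧ y₀ ≤ D - c - 2 * ‖e' - e‖ ^ 2 ∧
      ∀ t : ℝ, (φ (x' + t • e) - φ x' - (φ (x + t • e) - φ x)) ^ 4 ≤
        wedgeConst * (D - c - 2 * ‖e' - e‖ ^ 2) * t ^ 4 := by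
  rw [hasFDerivAt_iff_isLittleO_nhds_zero, Asymptotics.isLittleO_iff] at hnd
  push Not at hnd
  obtain ⟨ε₀, hε₀, hfreq⟩ := hnd
  set σ := min ε₀ 1 / 500 with hσdef
  have hσ : 0 < σ := by positivity
  have hσ' : σ ≤ 1 / 500 := by
    rw [hσdef]; gcongr; exact min_le_right _ _
  have hσε : 500 * σ ≤ ε₀ := by
    rw [hσdef, mul_div_cancel₀ _ (by norm_num)]; exact min_le_left _ _
  refine ⟨12 * σ ^ 2, by positivity, fun S hS ρ hρ => ?_⟩
  obtain ⟨ρ₀, hρ₀, hw⟩ := hS (σ ^ 5 / 200) (by positivity)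
  rw [hasLineDerivAt_iff_isLittleO_nhds_zero, Asymptotics.isLittleO_iff] at hd
  obtain ⟨δ, hδ, hd'⟩ := Metric.eventually_nhds_iff.1 (hd (show 0 < σ ^ 4 / 100 by positivity))
  set L := min (ρ₀ / 3) (min (ρ / 6) (δ * σ / 7)) with hL
  have hLpos : 0 < L := by positivity
  have hL1 : L ≤ ρ₀ / 3 := min_le_left _ _
  have hL2 : L ≤ ρ / 6 := (min_le_right _ _).trans (min_le_left _ _)
  have hL3 : L ≤ δ * σ / 7 := (min_le_right _ _).trans (min_le_right _ _)
  obtain ⟨u, hu, huL⟩ := (hfreq.and_eventually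
    (Metric.ball_mem_nhds (0 : E) (show 0 < σ * L by positivity))).exists
  rw [dist_zero_right] at huL
  rw [show (0 : E →L[ℝ] ℝ) u = 0 from rfl, sub_zero, Real.norm_eq_abs] at hu
  have hu0 : 0 < ‖u‖ := by
    rw [norm_pos_iff]; rintro rfl; simp at hu
  set ℓ := ‖u‖ / σ with hℓdef
  have hℓ : 0 < ℓ := by positivity
  have huℓ : ‖u‖ = σ * ℓ := by rw [hℓdef]; field_simp
  have hℓL : ℓ < L := by rw [hℓdef, div_lt_iff₀ hσ]; linarith
  have huℓ' : σ * ℓ ≤ 1 * ℓ := by gcongr; linarith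
  have heℓ : ‖ℓ • e‖ ≤ 2 * ℓ := by
    rw [norm_smul, Real.norm_of_nonneg hℓ.le, mul_comm]; gcongr
  obtain ⟨a₁, a₂, a₃, h₁, h₂, h₃, hs₁, hs₂⟩ := hw (2 * ℓ) (by positivity) (by linarith)
    (x - ℓ • e) (x + u) (x + ℓ • e) (by rw [sub_sub_cancel_left, norm_neg]; exact heℓ)
    (by rw [add_sub_cancel_left, huℓ]; linarith) (by rw [add_sub_cancel_left]; exact heℓ)
  have e1 : σ ^ 5 / 200 * (2 * ℓ) = σ ^ 5 / 100 * ℓ := by ring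
  rw [e1] at h₁ h₂ h₃
  obtain ⟨x', hx', e', D, hxx, hee, hD, hY, hinc⟩ :=
    exists_steep_point_on_wedge hφ hc he hσ hσ' hℓ huℓ (by
      refine lt_of_le_of_lt ?_ hu
      rw [huℓ]
      calc 500 * σ ^ 2 * ℓ = 500 * σ * (σ * ℓ) := by ring
        _ ≤ ε₀ * (σ * ℓ) := by gcongr) (fun t ht => by
      have htδ : dist t 0 < δ := by
        rw [Real.dist_eq, sub_zero]
        have : |t| * σ < δ * σ := by linarith
        exact lt_of_mul_lt_mul_right this hσ.le
      have := hd' htδ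
      simp only [smul_eq_mul, Real.norm_eq_abs] at this
      rwa [mul_comm t c] at this) h₁ h₂ h₃
  refine ⟨x', ?_, e', D, by linarith, hee, hD, hY, hinc⟩
  rcases hx' with h | h
  · exact hs₁ h
  · exact hs₂ h

/-- The difference between the increments of `f` at `x'` and at `x` along `v`. -/
def incDiff {V : Type*} [AddCommGroup V] (f : V → ℝ) (x x' v : V) : ℝ :=
  f (x' + v) - f x' - (f (x + v) - f x)

lemma LipschitzWith.abs_sub_le_norm {V : Type*} [SeminormedAddCommGroup V] {f : V → ℝ}
    (hf : LipschitzWith 1 f) (a b : V) :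
    |f a - f b| ≤ ‖a - b‖ := by
  have := hf.dist_le_mul a b
  rwa [Real.dist_eq, dist_eq_norm, NNReal.coe_one, one_mul] at this

lemma abs_incDiff_le {V : Type*} [SeminormedAddCommGroup V] {f : V → ℝ}
    (hf : LipschitzWith 1 f) (x x' v : V) :
    |incDiff f x x' v| ≤ 2 * ‖v‖ := by
  have h1 := hf.abs_sub_le_norm (x' + v) x'
  have h2 := hf.abs_sub_le_norm (x + v) x
  rw [add_sub_cancel_left] at h1 h2
  rw [incDiff]
  exact (abs_sub _ _).trans (by linarith)

lemma abs_incDiff_le' {V : Type*} [SeminormedAddCommGroup V] {f : V → ℝ}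
    (hf : LipschitzWith 1 f) (x x' v : V) :
    |incDiff f x x' v| ≤ 2 * ‖x' - x‖ := by
  have h1 := hf.abs_sub_le_norm (x' + v) (x + v)
  have h2 := hf.abs_sub_le_norm x' x
  rw [add_sub_add_right_eq_sub] at h1
  rw [show incDiff f x x' v = (f (x' + v) - f (x + v)) - (f x' - f x) by rw [incDiff]; ring]
  exact (abs_sub _ _).trans (by linarith)

lemma incDiff_self {V : Type*} [AddCommGroup V] (f : V → ℝ) (x v : V) :
    incDiff f x x v = 0 := by
  simp [incDiff]

lemma exists_incDiff_transfer {f : E → ℝ} (hf : LipschitzWith 1 f) {x₀ x₁ e₀ e₁ : E} {d₀ d₁ : ℝ}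
    (h₀ : HasLineDerivAt ℝ f d₀ x₀ e₀) (h₁ : HasLineDerivAt ℝ f d₁ x₁ e₁) {ζ : ℝ} (hζ : 0 < ζ) :
    ∃ δ > 0, ∀ x₂, ‖x₂ - x₁‖ < δ → ∀ t : ℝ,
      |incDiff f x₀ x₂ (t • e₀)| ≤ |incDiff f x₀ x₁ (t • e₀)| + ζ * |t| ∨
      |incDiff f x₀ x₂ (t • e₀)| ≤
        |incDiff f x₁ x₂ (t • e₁)| + (ζ + |d₁ - d₀| + ‖e₁ - e₀‖) * |t| := by
  rw [hasLineDerivAt_iff_isLittleO_nhds_zero, Asymptotics.isLittleO_iff] at h₀ h₁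
  obtain ⟨s, hs, hs'⟩ := Metric.eventually_nhds_iff.1 ((h₀ (half_pos hζ)).and (h₁ (half_pos hζ)))
  refine ⟨ζ * s / 2, by positivity, fun x₂ hx₂ t => ?_⟩
  rcases le_or_gt s |t| with ht | ht
  · left
    have e1 : incDiff f x₀ x₂ (t • e₀)
        = incDiff f x₀ x₁ (t • e₀) + incDiff f x₁ x₂ (t • e₀) := by
      simp only [incDiff]; ring
    have h2 := abs_incDiff_le' hf x₁ x₂ (t • e₀)
    have h3 : ζ * s ≤ ζ * |t| := by gcongr
    rw [e1]
    exact (abs_add_le _ _).trans (by linarith)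
  · right
    obtain ⟨k₀, k₁⟩ := hs' (y := t) (by rwa [Real.dist_eq, sub_zero])
    simp only [smul_eq_mul, Real.norm_eq_abs] at k₀ k₁
    have e1 : incDiff f x₀ x₂ (t • e₀) = incDiff f x₁ x₂ (t • e₁)
        + (f (x₂ + t • e₀) - f (x₂ + t • e₁)) + (f (x₁ + t • e₁) - f x₁ - t * d₁)
        - (f (x₀ + t • e₀) - f x₀ - t * d₀) + t * (d₁ - d₀) := by
      simp only [incDiff]; ring
    have h2 := hf.abs_sub_le_norm (x₂ + t • e₀) (x₂ + t • e₁)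
    rw [add_sub_add_left_eq_sub, ← smul_sub, norm_smul, Real.norm_eq_abs, norm_sub_rev] at h2
    have h3 : |t * (d₁ - d₀)| = |t| * |d₁ - d₀| := abs_mul _ _
    rw [e1]
    refine (abs_add_le _ _).trans ((add_le_add_left ((abs_sub _ _).trans
      (add_le_add_left ((abs_add_le _ _).trans (add_le_add_left (abs_add_le _ _) _)) _)) _).trans
        ?_)
    linarith

lemma add_pow_four_le_of_le {u w R : ℝ} (hu : 0 ≤ u) (hw : 0 ≤ w) (h : u + w ≤ R) :
    (u + w) ^ 4 ≤ u ^ 4 + 4 * R ^ 3 * w := by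
  have h1 : (u + w) ^ 4 - u ^ 4 ≤ 4 * (u + w) ^ 3 * w := by
    have : 4 * (u + w) ^ 3 * w - ((u + w) ^ 4 - u ^ 4)
        = w ^ 2 * (6 * u ^ 2 + 8 * u * w + 3 * w ^ 2) := by ring
    have : 0 ≤ w ^ 2 * (6 * u ^ 2 + 8 * u * w + 3 * w ^ 2) := by positivity
    linarith
  have h2 : 4 * (u + w) ^ 3 * w ≤ 4 * R ^ 3 * w := by gcongr
  linarith

lemma exists_incDiff_pow_four_le {f : E → ℝ} (hf : LipschitzWith 1 f) {x₀ x₁ e₀ e₁ : E}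
    {d₀ d₁ : ℝ} (h₀ : HasLineDerivAt ℝ f d₀ x₀ e₀) (h₁ : HasLineDerivAt ℝ f d₁ x₁ e₁)
    (he₀ : ‖e₀‖ ≤ 2) (he₁ : ‖e₁‖ ≤ 2) {K a σ₀ σ₁ m : ℝ} (hK : 8788 ≤ K) (ha : 0 ≤ a)
    (hσ₀ : 0 < σ₀) (hm : 0 < m) (hκ : ‖e₁ - e₀‖ ≤ σ₀ / 500000)
    (hd : |d₁ - d₀| ≤ a + 12 * ‖e₁ - e₀‖)
    (h : ∀ t : ℝ, incDiff f x₀ x₁ (t • e₀) ^ 4 ≤ (K * a + σ₁) * t ^ 4) :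
    ∃ δ > 0, ∀ x₂, ‖x₂ - x₁‖ < δ → ∀ b, 0 ≤ b →
      (∀ t : ℝ, incDiff f x₁ x₂ (t • e₁) ^ 4 ≤ (K * b + σ₀ / 4) * t ^ 4) →
      ∀ t : ℝ, incDiff f x₀ x₂ (t • e₀) ^ 4 ≤
        (K * (a + b) + max (σ₁ + m) (3 / 4 * σ₀)) * t ^ 4 := by
  set ζ := min (min 1 (m / 500)) (σ₀ / 40000) with hζdef
  have hζ : 0 < ζ := by positivity
  have hζ1 : ζ ≤ 1 := (min_le_left _ _).trans (min_le_left _ _)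
  have hζ2 : ζ ≤ m / 500 := (min_le_left _ _).trans (min_le_right _ _)
  have hζ3 : ζ ≤ σ₀ / 40000 := min_le_right _ _
  obtain ⟨δ, hδ, H⟩ := exists_incDiff_transfer hf h₀ h₁ hζ
  refine ⟨δ, hδ, fun x₂ hx₂ b hb hinc t => ?_⟩
  have h4 : ∀ a : ℝ, |a| ^ 4 = a ^ 4 := fun a => (show Even 4 by decide).pow_abs a
  have ht0 := abs_nonneg t
  have ht4 : 0 ≤ |t| ^ 4 := by positivity
  have hsize : ∀ x x' e : E, ‖e‖ ≤ 2 → |incDiff f x x' (t • e)| ≤ 4 * |t| := by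
    intro x x' e he
    refine (abs_incDiff_le hf x x' _).trans ?_
    rw [norm_smul, Real.norm_eq_abs]
    have := mul_le_mul_of_nonneg_left he ht0
    linarith
  have hdle : ∀ (d : ℝ) (x e : E), ‖e‖ ≤ 2 → HasLineDerivAt ℝ f d x e → |d| ≤ 2 := by
    intro d x e he hde
    have := hde.le_of_lipschitz hf
    rw [NNReal.coe_one, one_mul] at this
    exact this.trans he
  have hdd : |d₁ - d₀| ≤ 4 := (abs_sub _ _).trans
    (by linarith [hdle d₀ x₀ e₀ he₀ h₀, hdle d₁ x₁ e₁ he₁ h₁])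
  have hee : ‖e₁ - e₀‖ ≤ 4 := (norm_sub_le _ _).trans (by linarith)
  rcases H x₂ hx₂ t with hA | hA
  · have hw : 0 ≤ ζ * |t| := by positivity
    have hR : |incDiff f x₀ x₁ (t • e₀)| + ζ * |t| ≤ 5 * |t| := by
      have := mul_le_mul_of_nonneg_right hζ1 ht0
      linarith [hsize x₀ x₁ e₀ he₀]
    have h2 := pow_le_pow_left₀ (abs_nonneg _) hA 4
    have h3 := add_pow_four_le_of_le (abs_nonneg _) hw hR
    rw [h4] at h2 h3
    have h5 : 4 * (5 * |t|) ^ 3 * (ζ * |t|) = 500 * ζ * t ^ 4 := by rw [← h4 t]; ring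
    calc _ ≤ _ := h2
      _ ≤ _ := h3
      _ ≤ (K * a + σ₁) * t ^ 4 + 500 * ζ * t ^ 4 := by rw [h5]; gcongr; exact h t
      _ ≤ _ := by
        rw [← add_mul, ← h4 t]
        refine mul_le_mul_of_nonneg_right ?_ ht4
        have := le_max_left (σ₁ + m) (3 / 4 * σ₀)
        have := mul_nonneg (show 0 ≤ K by linarith) hb
        linarith
  · have hw : 0 ≤ (ζ + |d₁ - d₀| + ‖e₁ - e₀‖) * |t| := by positivity
    have hR : |incDiff f x₁ x₂ (t • e₁)| + (ζ + |d₁ - d₀| + ‖e₁ - e₀‖) * |t| ≤ 13 * |t| := by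
      have := mul_le_mul_of_nonneg_right (show ζ + |d₁ - d₀| + ‖e₁ - e₀‖ ≤ 9 by linarith) ht0
      linarith [hsize x₁ x₂ e₁ he₁]
    have h2 := pow_le_pow_left₀ (abs_nonneg _) hA 4
    have h3 := add_pow_four_le_of_le (abs_nonneg _) hw hR
    rw [h4] at h2 h3
    have h5 : 4 * (13 * |t|) ^ 3 * ((ζ + |d₁ - d₀| + ‖e₁ - e₀‖) * |t|)
        = 8788 * (ζ + |d₁ - d₀| + ‖e₁ - e₀‖) * t ^ 4 := by rw [← h4 t]; ring
    calc _ ≤ _ := h2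
      _ ≤ _ := h3
      _ ≤ (K * b + σ₀ / 4) * t ^ 4 + 8788 * (ζ + |d₁ - d₀| + ‖e₁ - e₀‖) * t ^ 4 := by
        rw [h5]; gcongr; exact hinc t
      _ ≤ _ := by
        rw [← add_mul, ← h4 t]
        refine mul_le_mul_of_nonneg_right ?_ ht4
        have := le_max_right (σ₁ + m) (3 / 4 * σ₀)
        have := mul_nonneg (show 0 ≤ K - 8788 by linarith) ha
        linarith

lemma HasLineDerivAt.abs_sub_le_of_increment {f : E → ℝ} {x₀ x₁ e₀ e₁ : E} {d₀ d₁ η : ℝ}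
    (h₀ : HasLineDerivAt ℝ f d₀ x₀ e₀) (h₁ : HasLineDerivAt ℝ f d₁ x₁ e₁) (hη : 0 ≤ η)
    (h : ∀ t : ℝ, |f (x₁ + t • e₁) - f x₁ - (f (x₀ + t • e₀) - f x₀)| ≤ η * |t|) :
    |d₁ - d₀| ≤ η := by
  have := (HasDerivAt.sub h₁ h₀).le_of_lip' hη (Eventually.of_forall fun t => by
    have := h t
    simp only [Pi.sub_apply, zero_smul, add_zero, sub_zero, Real.norm_eq_abs]
    convert this using 2
    ring)
  simpa using this

lemma exists_hasLineDerivAt_of_approx {f : E → ℝ} {x e : E} {xs es : ℕ → E} {ds : ℕ → ℝ}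
    (hd : ∀ j, HasLineDerivAt ℝ f (ds j) (xs j) (es j))
    (h : ∀ η > 0, ∃ J, ∀ j ≥ J, ∀ t : ℝ,
      |f (x + t • e) - f x - (f (xs j + t • es j) - f (xs j))| ≤ η * |t|) :
    ∃ d, HasLineDerivAt ℝ f d x e ∧ Tendsto ds atTop (𝓝 d) := by
  have hc : CauchySeq ds := by
    refine Metric.cauchySeq_iff'.2 fun ε hε => ?_
    obtain ⟨J, hJ⟩ := h (ε / 4) (by positivity)
    refine ⟨J, fun n hn => ?_⟩
    rw [Real.dist_eq]
    refine lt_of_le_of_lt (b := ε / 2) ?_ (by linarith)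
    refine (hd J).abs_sub_le_of_increment (hd n) (by positivity) fun t => ?_
    have h1 := hJ n hn t
    have h2 := hJ J le_rfl t
    rw [abs_le] at h1 h2 ⊢
    constructor <;> linarith
  obtain ⟨d, hlim⟩ := cauchySeq_tendsto_of_complete hc
  refine ⟨d, ?_, hlim⟩
  rw [hasLineDerivAt_iff_isLittleO_nhds_zero, Asymptotics.isLittleO_iff]
  intro η hη
  obtain ⟨J, hJ⟩ := h (η / 3) (by positivity)
  obtain ⟨N, hN⟩ := Metric.tendsto_atTop.1 hlim (η / 3) (by positivity)
  set j := max J N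
  have h1 := hJ j (le_max_left _ _)
  have h2 := hN j (le_max_right _ _)
  have h3 := hd j
  rw [hasLineDerivAt_iff_isLittleO_nhds_zero, Asymptotics.isLittleO_iff] at h3
  filter_upwards [h3 (show 0 < η / 3 by positivity)] with t ht
  rw [Real.dist_eq] at h2
  rw [Real.norm_eq_abs, Real.norm_eq_abs, smul_eq_mul] at ht ⊢
  have h4 : |t * (ds j - d)| ≤ |t| * (η / 3) := by
    rw [abs_mul]; gcongr
  have h1 := h1 t
  rw [abs_le] at h1 ht h4 ⊢
  constructor <;> linarith

lemma exists_increase_of_not_hasFDerivAt {f : E → ℝ} (hf : LipschitzWith 1 f) {x e g : E}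
    {d : ℝ} (he : ‖e‖ ≤ 2) (hg : ‖g‖ ≤ 8) (hd : HasLineDerivAt ℝ f d x e)
    (hnd : ¬ HasFDerivAt f (innerSL ℝ g) x) :
    ∃ y₀ : ℝ, 0 < y₀ ∧ ∀ S, HasWedges x S → ∀ ρ > 0, ∃ x' ∈ S, ∃ e' D, ‖x' - x‖ < ρ ∧
      ‖e' - e‖ ≤ 1 ∧ HasLineDerivAt ℝ f D x' e' ∧
      y₀ ≤ D - d - inner ℝ g (e' - e) - 2 * ‖e' - e‖ ^ 2 ∧
      ∀ t : ℝ, incDiff f x x' (t • e) ^ 4 ≤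
        wedgeConst * (D - d - inner ℝ g (e' - e) - 2 * ‖e' - e‖ ^ 2) * t ^ 4 := by
  set φ : E → ℝ := fun v => f v - innerSL ℝ g v with hφ
  have hline : ∀ {D x' e'}, HasLineDerivAt ℝ φ D x' e' ↔
      HasLineDerivAt ℝ f (D + inner ℝ g e') x' e' := by
    intro D x' e'
    have hl : HasLineDerivAt ℝ (innerSL ℝ g) (inner ℝ g e') x' e' :=
      (innerSL ℝ g).hasFDerivAt.hasLineDerivAt e'
    constructor
    · intro h
      have := HasDerivAt.add h hl
      refine this.congr_of_eventuallyEq (Eventually.of_forall fun t => ?_)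
      simp [hφ]
    · intro h
      have := HasDerivAt.sub h hl
      rw [add_sub_cancel_right] at this
      exact this
  have hφL : LipschitzWith 9 φ := by
    refine LipschitzWith.of_dist_le_mul fun a b => ?_
    rw [Real.dist_eq, dist_eq_norm, show ((9 : ℝ≥0) : ℝ) = 9 by norm_num]
    have e1 : φ a - φ b = (f a - f b) - inner ℝ g (a - b) := by
      simp only [hφ, innerSL_apply_apply, inner_sub_right]; ring
    have h1 := hf.abs_sub_le_norm a b
    have h2 := abs_real_inner_le_norm g (a - b)
    have h3 := mul_le_mul_of_nonneg_right hg (norm_nonneg (a - b))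
    rw [e1]
    exact (abs_sub _ _).trans (by linarith)
  have hd' : HasLineDerivAt ℝ φ (d - inner ℝ g e) x e := by
    rw [hline, sub_add_cancel]; exact hd
  have hc : |d - inner ℝ g e| ≤ 18 := by
    have := hd'.le_of_lipschitz hφL
    rw [show ((9 : ℝ≥0) : ℝ) = 9 by norm_num, Real.norm_eq_abs] at this
    linarith
  obtain ⟨y₀, hy₀, H⟩ := exists_increase_of_not_hasFDerivAt_zero hφL hc he hd' (by
    intro h
    apply hnd
    have := h.add (innerSL ℝ g).hasFDerivAt
    rw [zero_add] at this
    refine this.congr_of_eventuallyEq (Eventually.of_forall fun v => ?_)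
    simp [hφ])
  refine ⟨y₀, hy₀, fun S hS ρ hρ => ?_⟩
  obtain ⟨x', hx', e', D, hxx, hee, hD, hY, hinc⟩ := H S hS ρ hρ
  have e1 : D + inner ℝ g e' - d - inner ℝ g (e' - e) - 2 * ‖e' - e‖ ^ 2
      = D - (d - inner ℝ g e) - 2 * ‖e' - e‖ ^ 2 := by rw [inner_sub_right]; ring
  refine ⟨x', hx', e', D + inner ℝ g e', hxx, hee, hline.1 hD, by rw [e1]; exact hY, fun t => ?_⟩
  rw [e1]
  convert hinc t using 2
  simp only [hφ, incDiff, innerSL_apply_apply, inner_add_right]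
  ring

/-- A stage of the search for a point with an almost maximal directional derivative: a point, a
direction, a penalty on directions, an upper bound on the level of the sets searched, and the
radius of the search. -/
structure SearchState (E : Type*) where
  pt : E
  dir : E
  pen : E → ℝ
  lvl : ℝ
  rad : ℝ

namespace SearchState

/-- The penalty of the next stage, where `σ` is the scale of the current one. -/
noncomputable def nextPen (σ : ℝ) (s : SearchState E) (v : E) : ℝ :=
  s.pen v + σ / 4 * ‖v - s.dir‖ ^ 2

/-- The increase of the penalized directional derivative from the state to `(x', e')`. -/
noncomputable def gain (f : E → ℝ) (σ : ℝ) (s : SearchState E) (x' e' : E) : ℝ :=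
  lineDeriv ℝ f x' e' - s.nextPen σ e' - (lineDeriv ℝ f s.pt s.dir - s.pen s.dir)

/-- The pairs that may be reached from the state `s`. -/
def IsCandidate (f : E → ℝ) (M : ℝ → Set E) (σ : ℝ) (s : SearchState E) (x' e' : E) : Prop :=
  (∃ l, 0 ≤ l ∧ l < s.lvl ∧ x' ∈ M l) ∧ LineDifferentiableAt ℝ f x' e' ∧
    ‖x' - s.pt‖ < s.rad ∧ 0 ≤ s.gain f σ x' e' ∧
    ∃ τ < σ, ∀ t : ℝ, incDiff f s.pt x' (t • s.dir) ^ 4 ≤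
      (4 * wedgeConst * s.gain f σ x' e' + τ) * t ^ 4

/-- The invariant of the search at scale `σ`. -/
structure Valid (f : E → ℝ) (M : ℝ → Set E) (σ : ℝ) (s : SearchState E) : Prop where
  diff : LineDifferentiableAt ℝ f s.pt s.dir
  mem : ∃ l, 0 ≤ l ∧ l < s.lvl ∧ s.pt ∈ M l
  lvl_le : s.lvl ≤ 1
  rad_pos : 0 < s.rad
  rad_le : s.rad ≤ σ
  norm_dir_le : ‖s.dir‖ ≤ 2
  sq_le_pen : ∀ v, ‖v‖ ^ 2 ≤ s.pen v
  neg_one_le : -1 ≤ lineDeriv ℝ f s.pt s.dir - s.pen s.dir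
  abs_pen_sub_le : ∀ v w, ‖v‖ ≤ 2 → ‖w‖ ≤ 2 → |s.pen v - s.pen w| ≤ (12 - 8 * σ) * ‖v - w‖
  near_max : ∀ x' e', IsCandidate f M σ s x' e' → lineDeriv ℝ f x' e' - s.pen e' ≤
    lineDeriv ℝ f s.pt s.dir - s.pen s.dir + σ ^ 3 / 10 ^ 13

/-- The relation between consecutive stages of the search. -/
structure Succ (f : E → ℝ) (M : ℝ → Set E) (σ : ℝ) (s s' : SearchState E) : Prop where
  pen_eq : s'.pen = s.nextPen σ
  cand : IsCandidate f M σ s s'.pt s'.dir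
  near_max : ∀ x' e', IsCandidate f M σ s x' e' → lineDeriv ℝ f x' e' - s'.pen e' ≤
    lineDeriv ℝ f s'.pt s'.dir - s'.pen s'.dir + (σ / 4) ^ 3 / 10 ^ 13
  lvl_lt : s'.lvl < s.lvl
  rad_le : s'.rad ≤ (s.rad - ‖s'.pt - s.pt‖) / 2
  cand_of_cand : ∀ x' e', IsCandidate f M (σ / 4) s' x' e' → IsCandidate f M σ s x' e'

variable {f : E → ℝ} {M : ℝ → Set E} {σ : ℝ} {s s' : SearchState E}

lemma gain_self : s.gain f σ s.pt s.dir = 0 := by simp [gain, nextPen]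

lemma Valid.isCandidate_self (h : s.Valid f M σ) (hσ : 0 < σ) :
    IsCandidate f M σ s s.pt s.dir := by
  refine ⟨h.mem, h.diff, by simpa using h.rad_pos, gain_self.ge, σ / 2, by linarith, fun t => ?_⟩
  rw [incDiff_self, gain_self]
  have : 0 ≤ σ / 2 * t ^ 4 := by positivity
  linarith

lemma lineDeriv_le_norm (hf : LipschitzWith 1 f) (x e : E) : lineDeriv ℝ f x e ≤ ‖e‖ := by
  have := norm_lineDeriv_le_of_lipschitz ℝ (x₀ := x) (v := e) hf
  rw [NNReal.coe_one, one_mul] at this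
  exact (le_abs_self _).trans this

lemma Valid.norm_le_two (h : s.Valid f M σ) (hf : LipschitzWith 1 f) (hσ : 0 ≤ σ) {x' e' : E}
    (hg : 0 ≤ s.gain f σ x' e') : ‖e'‖ ≤ 2 := by
  have h1 := lineDeriv_le_norm hf x' e'
  have h2 := h.sq_le_pen e'
  have h3 := h.neg_one_le
  rw [gain, nextPen] at hg
  have h4 : 0 ≤ σ / 4 * ‖e' - s.dir‖ ^ 2 := by positivity
  nlinarith [norm_nonneg e']

lemma Valid.norm_dir_sub_le (h : s.Valid f M σ) (hσ : 0 < σ) {x' e' : E}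
    (hc : IsCandidate f M σ s x' e') : ‖e' - s.dir‖ ≤ σ / 10 ^ 6 := by
  have h1 := h.near_max x' e' hc
  have h2 := hc.2.2.2.1
  rw [gain, nextPen] at h2
  have h3 : ‖e' - s.dir‖ ^ 2 ≤ (σ / 10 ^ 6) ^ 2 := by
    have : σ / 4 * ‖e' - s.dir‖ ^ 2 ≤ σ / 4 * (σ / 10 ^ 6) ^ 2 := by
      have : σ ^ 3 / 10 ^ 13 ≤ σ / 4 * (σ / 10 ^ 6) ^ 2 := by
        have : 0 < σ ^ 3 := by positivity
        ring_nf; linarith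
      linarith
    exact le_of_mul_le_mul_left this (by positivity)
  exact (pow_le_pow_iff_left₀ (norm_nonneg _) (by positivity) two_ne_zero).1 h3

lemma Valid.abs_nextPen_sub_le (h : s.Valid f M σ) (hσ : 0 < σ) {v w : E} (hv : ‖v‖ ≤ 2)
    (hw : ‖w‖ ≤ 2) : |s.nextPen σ v - s.nextPen σ w| ≤ (12 - 8 * (σ / 4)) * ‖v - w‖ := by
  have h1 := h.abs_pen_sub_le v w hv hw
  have h2 : |‖v - s.dir‖ - ‖w - s.dir‖| ≤ ‖v - w‖ := by
    simpa using abs_norm_sub_norm_le (v - s.dir) (w - s.dir)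
  have h3 : ‖v - s.dir‖ ≤ 4 := (norm_sub_le _ _).trans (by linarith [h.norm_dir_le])
  have h4 : ‖w - s.dir‖ ≤ 4 := (norm_sub_le _ _).trans (by linarith [h.norm_dir_le])
  have h5 : |σ / 4 * ‖v - s.dir‖ ^ 2 - σ / 4 * ‖w - s.dir‖ ^ 2| ≤ σ / 4 * (‖v - w‖ * 8) := by
    rw [← mul_sub, abs_mul, abs_of_pos (by positivity : 0 < σ / 4), sq_sub_sq,
      abs_mul, mul_comm |_|]
    gcongr
    rw [abs_of_nonneg (by positivity)]
    linarith
  have h6 : s.nextPen σ v - s.nextPen σ w = (s.pen v - s.pen w) +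
      (σ / 4 * ‖v - s.dir‖ ^ 2 - σ / 4 * ‖w - s.dir‖ ^ 2) := by
    simp only [nextPen]; ring
  rw [h6]
  refine (abs_add_le _ _).trans ?_
  nlinarith [norm_nonneg (v - w)]

lemma Valid.abs_lineDeriv_sub_le (h : s.Valid f M σ) (hf : LipschitzWith 1 f) (hσ : 0 < σ)
    {x' e' : E} (hg : 0 ≤ s.gain f σ x' e') :
    |lineDeriv ℝ f x' e' - lineDeriv ℝ f s.pt s.dir| ≤
      s.gain f σ x' e' + 12 * ‖e' - s.dir‖ := by
  have h1 := h.abs_nextPen_sub_le hσ (h.norm_le_two hf hσ.le hg) h.norm_dir_le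
  have h2 : lineDeriv ℝ f x' e' - lineDeriv ℝ f s.pt s.dir =
      s.gain f σ x' e' + (s.nextPen σ e' - s.nextPen σ s.dir) := by
    simp [gain, nextPen]
    ring
  rw [h2]
  refine (abs_add_le _ _).trans ?_
  rw [abs_of_nonneg hg]
  have : 0 ≤ 8 * (σ / 4) * ‖e' - s.dir‖ := by positivity
  linarith

lemma wedgeConst_ge : 8788 ≤ 4 * wedgeConst := by norm_num [wedgeConst]

lemma Valid.exists_succ (h : s.Valid f M σ) (hf : LipschitzWith 1 f) (hσ : 0 < σ) :
    ∃ s' : SearchState E, s'.Valid f M (σ / 4) ∧ Succ f M σ s s' := by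
  set A : Set ℝ :=
    {r | ∃ x' e', IsCandidate f M σ s x' e' ∧ r = lineDeriv ℝ f x' e' - s.nextPen σ e'} with hA
  have hAne : A.Nonempty := ⟨_, _, _, h.isCandidate_self hσ, rfl⟩
  have hAb : BddAbove A := by
    refine ⟨1, ?_⟩
    rintro _ ⟨x', e', -, rfl⟩
    have h1 := lineDeriv_le_norm hf x' e'
    have h2 := h.sq_le_pen e'
    have h4 : 0 ≤ σ / 4 * ‖e' - s.dir‖ ^ 2 := by positivity
    rw [nextPen]
    nlinarith [sq_nonneg (‖e'‖ - 1)]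
  obtain ⟨_, ⟨x', e', hc, rfl⟩, hlt⟩ := exists_lt_of_lt_csSup hAne
    (show sSup A - (σ / 4) ^ 3 / 10 ^ 13 < sSup A by
      have : 0 < (σ / 4) ^ 3 / 10 ^ 13 := by positivity
      linarith)
  have hmax : ∀ x'' e'', IsCandidate f M σ s x'' e'' → lineDeriv ℝ f x'' e'' - s.nextPen σ e'' ≤
      lineDeriv ℝ f x' e' - s.nextPen σ e' + (σ / 4) ^ 3 / 10 ^ 13 := by
    intro x'' e'' hc'
    have := le_csSup hAb ⟨x'', e'', hc', rfl⟩
    linarith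
  obtain ⟨⟨l, hl0, hl, hxl⟩, hdiff, hx, hg, τ, hτ, hinc⟩ := id hc
  have he' := h.norm_le_two hf hσ.le hg
  obtain ⟨δ, hδ, hδ'⟩ := exists_incDiff_pow_four_le (m := (σ - τ) / 2) hf
    h.diff.hasLineDerivAt hdiff.hasLineDerivAt h.norm_dir_le he' wedgeConst_ge hg hσ
    (by linarith) ((h.norm_dir_sub_le hσ hc).trans (by linarith)) (h.abs_lineDeriv_sub_le hf hσ hg)
    hinc
  set s' : SearchState E := ⟨x', e', s.nextPen σ, (l + s.lvl) / 2,
    min (min (σ / 4) δ) ((s.rad - ‖x' - s.pt‖) / 2)⟩ with hs'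
  have hcc : ∀ x'' e'', IsCandidate f M (σ / 4) s' x'' e'' → IsCandidate f M σ s x'' e'' := by
    rintro x'' e'' ⟨⟨l', hl'0, hl', hxl'⟩, hdiff', hx', hg', τ', hτ', hinc'⟩
    have hgg : s.gain f σ x' e' + s'.gain f (σ / 4) x'' e'' ≤ s.gain f σ x'' e'' := by
      simp only [gain, nextPen, hs']
      have : 0 ≤ σ / 4 / 4 * ‖e'' - e'‖ ^ 2 := by positivity
      linarith
    have hx1 : ‖x'' - x'‖ < δ := hx'.trans_le ((min_le_left _ _).trans (min_le_right _ _))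
    have hx2 : ‖x'' - x'‖ < (s.rad - ‖x' - s.pt‖) / 2 := hx'.trans_le (min_le_right _ _)
    refine ⟨⟨l', hl'0, ?_, hxl'⟩, hdiff', ?_, by linarith, max (τ + (σ - τ) / 2) (3 / 4 * σ),
      max_lt (by linarith) (by linarith), fun t => ?_⟩
    · have : l' < (l + s.lvl) / 2 := hl'
      linarith
    · have := norm_sub_le_norm_sub_add_norm_sub x'' x' s.pt
      linarith
    · refine (hδ' x'' hx1 _ hg' (fun t => (hinc' t).trans ?_) t).trans ?_
      · gcongr
      · have : 0 ≤ 4 * wedgeConst := by linarith [wedgeConst_ge]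
        gcongr
  refine ⟨s', ?_, ?_⟩
  · refine ⟨hdiff, ⟨l, hl0, ?_, hxl⟩, ?_, ?_, (min_le_left _ _).trans (min_le_left _ _),
      he', fun v => ?_, ?_, ?_, ?_⟩
    · show l < (l + s.lvl) / 2
      linarith
    · show (l + s.lvl) / 2 ≤ 1
      linarith [h.lvl_le]
    · show 0 < min _ _
      have : 0 < (s.rad - ‖x' - s.pt‖) / 2 := by linarith
      positivity
    · refine (h.sq_le_pen v).trans ?_
      have : 0 ≤ σ / 4 * ‖v - s.dir‖ ^ 2 := by positivity
      show _ ≤ s.nextPen σ v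
      rw [nextPen]
      linarith
    · show -1 ≤ lineDeriv ℝ f x' e' - s.nextPen σ e'
      rw [gain] at hg
      linarith [h.neg_one_le]
    · exact fun v w hv hw => h.abs_nextPen_sub_le hσ hv hw
    · exact fun x'' e'' hc' => hmax x'' e'' (hcc x'' e'' hc')
  · refine ⟨rfl, hc, hmax, ?_, min_le_right _ _, hcc⟩
    show (l + s.lvl) / 2 < s.lvl
    linarith

end SearchState

namespace SearchState

variable {f : E → ℝ} {M : ℝ → Set E}

lemma exists_valid (hf : LipschitzWith 1 f) (hne : (M 0).Nonempty) :
    ∃ s : SearchState E, s.Valid f M 1 ∧ s.pen = fun v => ‖v‖ ^ 2 := by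
  set A : Set ℝ := {r | ∃ x e, (∃ l, 0 ≤ l ∧ l < 1 ∧ x ∈ M l) ∧ LineDifferentiableAt ℝ f x e ∧
    r = lineDeriv ℝ f x e - ‖e‖ ^ 2} with hA
  obtain ⟨p, hp⟩ := hne
  have h0A : (0 : ℝ) ∈ A :=
    ⟨p, 0, ⟨0, le_rfl, one_pos, hp⟩, lineDifferentiableAt_zero, by simp [lineDeriv_zero]⟩
  have hAb : BddAbove A := by
    refine ⟨1, ?_⟩
    rintro _ ⟨x, e, -, -, rfl⟩
    have h1 := lineDeriv_le_norm hf x e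
    nlinarith [sq_nonneg (‖e‖ - 1)]
  obtain ⟨_, ⟨x, e, ⟨l, hl0, hl, hxl⟩, hdiff, rfl⟩, hlt⟩ := exists_lt_of_lt_csSup ⟨0, h0A⟩
    (show sSup A - 1 / 10 ^ 13 < sSup A by linarith [show (0 : ℝ) < 1 / 10 ^ 13 by positivity])
  have h0 : -1 ≤ lineDeriv ℝ f x e - ‖e‖ ^ 2 := by
    have := le_csSup hAb h0A
    have : (1 : ℝ) / 10 ^ 13 ≤ 1 := by norm_num
    linarith
  have he : ‖e‖ ≤ 2 := by
    have := lineDeriv_le_norm hf x e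
    nlinarith [norm_nonneg e]
  refine ⟨⟨x, e, fun v => ‖v‖ ^ 2, 1, 1⟩, ⟨hdiff, ⟨l, hl0, hl, hxl⟩, le_rfl, one_pos, le_rfl, he,
    fun v => le_rfl, h0, fun v w hv hw => ?_, ?_⟩, rfl⟩
  · have h1 := abs_norm_sub_norm_le v w
    show |‖v‖ ^ 2 - ‖w‖ ^ 2| ≤ _
    rw [sq_sub_sq, abs_mul, abs_of_nonneg (by positivity : 0 ≤ ‖v‖ + ‖w‖)]
    gcongr
    linarith
  · rintro x' e' ⟨hm, hdiff', -⟩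
    have := le_csSup hAb ⟨x', e', hm, hdiff', rfl⟩
    show lineDeriv ℝ f x' e' - ‖e'‖ ^ 2 ≤ lineDeriv ℝ f x e - ‖e‖ ^ 2 + 1 ^ 3 / 10 ^ 13
    rw [one_pow]
    linarith

lemma exists_seq (hf : LipschitzWith 1 f) (hne : (M 0).Nonempty) :
    ∃ u : ℕ → SearchState E, ((u 0).pen = fun v => ‖v‖ ^ 2) ∧
      (∀ k, (u k).Valid f M ((1 / 4) ^ k)) ∧ ∀ k, Succ f M ((1 / 4) ^ k) (u k) (u (k + 1)) := by
  obtain ⟨s₀, hs₀, hp⟩ := exists_valid hf hne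
  have hnext : ∀ (k : ℕ) (s : {s : SearchState E // s.Valid f M ((1 / 4) ^ k)}),
      ∃ s' : {s : SearchState E // s.Valid f M ((1 / 4) ^ (k + 1))},
        Succ f M ((1 / 4) ^ k) s.1 s'.1 := by
    rintro k ⟨s, hs⟩
    obtain ⟨s', hs', h⟩ := hs.exists_succ hf (by positivity)
    exact ⟨⟨s', by rwa [pow_succ, mul_one_div]⟩, h⟩
  choose nx hnx using hnext
  let u : ∀ k : ℕ, {s : SearchState E // s.Valid f M ((1 / 4) ^ k)} :=
    fun k => Nat.rec ⟨s₀, by rwa [pow_zero]⟩ nx k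
  exact ⟨fun k => (u k).1, hp, fun k => (u k).2, fun k => hnx k (u k)⟩

lemma isCandidate_of_le {u : ℕ → SearchState E}
    (hv : ∀ k, (u k).Valid f M ((1 / 4) ^ k))
    (hs : ∀ k, Succ f M ((1 / 4) ^ k) (u k) (u (k + 1))) {k i : ℕ} (h : k ≤ i) :
    IsCandidate f M ((1 / 4) ^ k) (u k) (u i).pt (u i).dir := by
  have hsub : ∀ x' e', IsCandidate f M ((1 / 4) ^ i) (u i) x' e' →
      IsCandidate f M ((1 / 4) ^ k) (u k) x' e' := by
    induction i, h using Nat.le_induction with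
    | base => exact fun _ _ h => h
    | succ i _ ih =>
      intro x' e' h
      refine ih _ _ ((hs i).cand_of_cand _ _ ?_)
      rwa [pow_succ, mul_one_div] at h
  exact hsub _ _ ((hv i).isCandidate_self (by positivity))

lemma incDiff_pow_four_le_of_le {u : ℕ → SearchState E}
    (hv : ∀ k, (u k).Valid f M ((1 / 4) ^ k))
    (hs : ∀ k, Succ f M ((1 / 4) ^ k) (u k) (u (k + 1))) {k i : ℕ} (h : k ≤ i) (t : ℝ) :
    incDiff f (u k).pt (u i).pt (t • (u k).dir) ^ 4 ≤ 2 * (1 / 4) ^ k * t ^ 4 := by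
  obtain ⟨-, -, -, hg, τ, hτ, hinc⟩ := id (isCandidate_of_le hv hs h)
  refine (hinc t).trans ?_
  have h1 := (hv k).near_max _ _ (isCandidate_of_le hv hs h)
  set σ : ℝ := (1 / 4) ^ k with hσdef
  have hσ : 0 < σ := by positivity
  have hσ1 : σ ≤ 1 := pow_le_one₀ (by norm_num) (by norm_num)
  have h2 : (u k).gain f σ (u i).pt (u i).dir ≤ σ ^ 3 / 10 ^ 13 := by
    have : 0 ≤ σ / 4 * ‖(u i).dir - (u k).dir‖ ^ 2 := by positivity
    rw [gain, nextPen]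
    linarith
  have h3 : σ ^ 3 ≤ σ := by nlinarith [mul_pos hσ hσ]
  have h4 : 4 * wedgeConst * (u k).gain f σ (u i).pt (u i).dir ≤ σ := by
    have h5 : 4 * wedgeConst ≤ 10 ^ 12 := by norm_num [wedgeConst]
    calc 4 * wedgeConst * (u k).gain f σ (u i).pt (u i).dir ≤ 10 ^ 12 * (σ ^ 3 / 10 ^ 13) := by
          gcongr
      _ ≤ σ := by linarith
  have : 0 ≤ t ^ 4 := by positivity
  gcongr
  linarith

lemma exists_limit [CompleteSpace E] {u : ℕ → SearchState E}
    (hv : ∀ k, (u k).Valid f M ((1 / 4) ^ k))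
    (hs : ∀ k, Succ f M ((1 / 4) ^ k) (u k) (u (k + 1)))
    (hf : LipschitzWith 1 f) (hclosed : ∀ t, IsClosed (M t))
    (hmono : ∀ s t, 0 ≤ s → s ≤ t → t ≤ 1 → M s ⊆ M t) :
    ∃ x e, LineDifferentiableAt ℝ f x e ∧ ‖e‖ ≤ 2 ∧ ∀ k, x ∈ M (u k).lvl ∧
      ‖x - (u k).pt‖ < (u k).rad ∧ ‖e - (u k).dir‖ ≤ (1 / 4) ^ k / 500000 ∧
      0 ≤ (u k).gain f ((1 / 4) ^ k) x e ∧
      ∀ t : ℝ, incDiff f (u k).pt x (t • (u k).dir) ^ 4 ≤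
        (4 * wedgeConst * (u k).gain f ((1 / 4) ^ k) x e + (1 / 4) ^ k) * t ^ 4 := by
  have hpt : ∀ k, dist (u k).pt (u (k + 1)).pt ≤ 1 * (1 / 4) ^ k := by
    intro k
    rw [dist_comm, dist_eq_norm, one_mul]
    exact (hs k).cand.2.2.1.le.trans (hv k).rad_le
  have hdir : ∀ k, dist (u k).dir (u (k + 1)).dir ≤ (1 / 10 ^ 6) * (1 / 4) ^ k := by
    intro k
    rw [dist_comm, dist_eq_norm]
    exact ((hv k).norm_dir_sub_le (by positivity) (hs k).cand).trans (by linarith)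
  obtain ⟨x, hx⟩ := cauchySeq_tendsto_of_complete
    (cauchySeq_of_le_geometric (1 / 4) 1 (by norm_num) hpt)
  obtain ⟨e, he⟩ := cauchySeq_tendsto_of_complete
    (cauchySeq_of_le_geometric (1 / 4) (1 / 10 ^ 6) (by norm_num) hdir)
  have hfc := hf.continuous
  have hedist : ∀ k, ‖e - (u k).dir‖ ≤ (1 / 4) ^ k / 500000 := by
    intro k
    have := dist_le_of_le_geometric_of_tendsto (1 / 4) (1 / 10 ^ 6) (by norm_num) hdir he k
    rw [dist_comm, dist_eq_norm] at this
    refine this.trans ?_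
    have : (0 : ℝ) < (1 / 4) ^ k := by positivity
    rw [div_le_iff₀ (by norm_num)]
    linarith
  have he2 : ‖e‖ ≤ 2 :=
    le_of_tendsto he.norm (Eventually.of_forall fun k => (hv k).norm_dir_le)
  have hincx : ∀ k (t : ℝ), Tendsto (fun i => incDiff f (u k).pt (u i).pt (t • (u k).dir) ^ 4)
      atTop (𝓝 (incDiff f (u k).pt x (t • (u k).dir) ^ 4)) := by
    intro k t
    have : Continuous fun z => incDiff f (u k).pt z (t • (u k).dir) ^ 4 := by
      unfold incDiff; fun_prop
    exact (this.tendsto x).comp hx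
  have hinc2 : ∀ k (t : ℝ),
      incDiff f (u k).pt x (t • (u k).dir) ^ 4 ≤ 2 * (1 / 4) ^ k * t ^ 4 := fun k t =>
    le_of_tendsto (hincx k t) (eventually_atTop.2
      ⟨k, fun i hi => incDiff_pow_four_le_of_le hv hs hi t⟩)
  obtain ⟨d, hd, hdlim⟩ := exists_hasLineDerivAt_of_approx (x := x) (e := e)
    (fun j => (hv j).diff.hasLineDerivAt) (fun η hη => by
      have hpow : Tendsto (fun j : ℕ => (1 / 4 : ℝ) ^ j) atTop (𝓝 0) :=
        tendsto_pow_atTop_nhds_zero_of_lt_one (by norm_num) (by norm_num)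
      obtain ⟨J, hJ⟩ := eventually_atTop.1 ((hpow.eventually_lt_const
        (show 0 < min ((η / 2) ^ 4 / 2) η by positivity)))
      refine ⟨J, fun j hj t => ?_⟩
      have h1 := (hJ j hj).trans_le (min_le_left _ _)
      have h2 := (hJ j hj).trans_le (min_le_right _ _)
      have h3 : |incDiff f (u j).pt x (t • (u j).dir)| ≤ η / 2 * |t| := by
        refine (pow_le_pow_iff_left₀ (abs_nonneg _) (by positivity) four_ne_zero).1 ?_
        rw [mul_pow, Even.pow_abs (by decide), Even.pow_abs (by decide)]
        refine (hinc2 j t).trans ?_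
        have : 0 ≤ t ^ 4 := by positivity
        gcongr
        linarith
      have h4 : |f (x + t • e) - f (x + t • (u j).dir)| ≤ η / 2 * |t| := by
        refine (hf.abs_sub_le_norm _ _).trans ?_
        rw [add_sub_add_left_eq_sub, ← smul_sub, norm_smul, Real.norm_eq_abs, mul_comm]
        gcongr
        exact (hedist j).trans (by linarith)
      have h5 : f (x + t • e) - f x - (f ((u j).pt + t • (u j).dir) - f (u j).pt) =
          (f (x + t • e) - f (x + t • (u j).dir)) + incDiff f (u j).pt x (t • (u j).dir) := by
        rw [incDiff]; ring
      rw [h5]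
      exact (abs_add_le _ _).trans (by linarith))
  have hgain : ∀ k, Tendsto (fun i => (u k).gain f ((1 / 4) ^ k) (u i).pt (u i).dir) atTop
      (𝓝 ((u k).gain f ((1 / 4) ^ k) x e)) := by
    intro k
    have hpen : Tendsto (fun i => (u k).nextPen ((1 / 4) ^ k) (u i).dir) atTop
        (𝓝 ((u k).nextPen ((1 / 4) ^ k) e)) := by
      rw [tendsto_iff_norm_sub_tendsto_zero]
      have h0 : Tendsto (fun i => 12 * ‖(u i).dir - e‖) atTop (𝓝 0) := by
        simpa using (tendsto_iff_norm_sub_tendsto_zero.1 he).const_mul 12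
      refine squeeze_zero (fun _ => norm_nonneg _) (fun i => ?_) h0
      refine ((hv k).abs_nextPen_sub_le (by positivity) (hv i).norm_dir_le he2).trans ?_
      gcongr
      have : (0 : ℝ) < (1 / 4) ^ k := by positivity
      linarith
    have hd' : Tendsto (fun j => lineDeriv ℝ f (u j).pt (u j).dir) atTop
        (𝓝 (lineDeriv ℝ f x e)) := by rwa [hd.lineDeriv]
    exact (hd'.sub hpen).sub_const _
  refine ⟨x, e, hd.lineDifferentiableAt, he2, fun k => ⟨?_, ?_, hedist k, ?_, fun t => ?_⟩⟩
  · refine (hclosed _).mem_of_tendsto hx (eventually_atTop.2 ⟨k, fun i hi => ?_⟩)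
    obtain ⟨l, hl0, hl, hxl⟩ := (isCandidate_of_le hv hs hi).1
    exact hmono l _ hl0 hl.le (hv k).lvl_le hxl
  · have h1 : ‖x - (u (k + 1)).pt‖ ≤ (u (k + 1)).rad := by
      refine le_of_tendsto (hx.sub_const _).norm (eventually_atTop.2 ⟨k + 1, fun i hi => ?_⟩)
      exact (isCandidate_of_le hv hs hi).2.2.1.le
    have h2 := (hs k).rad_le
    have h3 := norm_sub_le_norm_sub_add_norm_sub x (u (k + 1)).pt (u k).pt
    have h4 := (hs k).cand.2.2.1
    linarith
  · exact ge_of_tendsto (hgain k) (eventually_atTop.2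
      ⟨k, fun i hi => (isCandidate_of_le hv hs hi).2.2.2.1⟩)
  · refine le_of_tendsto_of_tendsto (hincx k t)
      ((((hgain k).const_mul (4 * wedgeConst)).add_const _).mul_const _)
      (eventually_atTop.2 ⟨k, fun i hi => ?_⟩)
    obtain ⟨-, -, -, -, τ, hτ, hinc⟩ := isCandidate_of_le hv hs hi
    refine (hinc t).trans ?_
    exact mul_le_mul_of_nonneg_right (by linarith) (by positivity)

end SearchState

namespace SearchState

lemma exists_pen_expansion [CompleteSpace E] {u : ℕ → SearchState E} {e : E}
    (h0 : (u 0).pen = fun v => ‖v‖ ^ 2) (hu : ∀ k, (u (k + 1)).pen = (u k).nextPen ((1 / 4) ^ k))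
    (he : ‖e‖ ≤ 2) (hdist : ∀ k, ‖e - (u k).dir‖ ≤ 1) :
    ∃ (g : E) (G : ℕ → E), ‖g‖ ≤ 8 ∧ Tendsto G atTop (𝓝 g) ∧ ∀ k, ∃ B ≤ 2, ∀ v,
      (u k).pen v - (u k).pen e = B * ‖v - e‖ ^ 2 + inner ℝ (G k) (v - e) := by
  let G : ℕ → E :=
    fun k => Nat.rec ((2 : ℝ) • e) (fun k w => w + ((1 / 4 : ℝ) ^ k / 2) • (e - (u k).dir)) k
  have hG : ∀ k, G (k + 1) = G k + ((1 / 4 : ℝ) ^ k / 2) • (e - (u k).dir) := fun _ => rfl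
  have hGd : ∀ k, dist (G k) (G (k + 1)) ≤ 1 / 2 * (1 / 4) ^ k := by
    intro k
    rw [dist_comm, dist_eq_norm, hG, add_sub_cancel_left, norm_smul,
      Real.norm_of_nonneg (by positivity)]
    calc (1 / 4 : ℝ) ^ k / 2 * ‖e - (u k).dir‖ ≤ (1 / 4 : ℝ) ^ k / 2 * 1 := by
          gcongr; exact hdist k
      _ = 1 / 2 * (1 / 4) ^ k := by ring
  obtain ⟨g, hg⟩ := cauchySeq_tendsto_of_complete
    (cauchySeq_of_le_geometric (1 / 4) (1 / 2) (by norm_num) hGd)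
  refine ⟨g, G, ?_, hg, fun k => ?_⟩
  · have h1 := dist_le_of_le_geometric_of_tendsto₀ (1 / 4) (1 / 2) (by norm_num) hGd hg
    rw [dist_comm, dist_eq_norm] at h1
    have h2 : ‖G 0‖ ≤ 4 := by
      show ‖(2 : ℝ) • e‖ ≤ 4
      rw [norm_smul, Real.norm_of_nonneg (by norm_num)]
      linarith
    have h3 := norm_le_norm_add_norm_sub' g (G 0)
    norm_num at h1
    linarith
  · suffices h : ∃ B ≤ 2 - (1 / 4 : ℝ) ^ k, ∀ v,
        (u k).pen v - (u k).pen e = B * ‖v - e‖ ^ 2 + inner ℝ (G k) (v - e) by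
      obtain ⟨B, hB, h⟩ := h
      exact ⟨B, hB.trans (by linarith [show (0 : ℝ) < (1 / 4) ^ k by positivity]), h⟩
    induction k with
    | zero =>
      refine ⟨1, by norm_num, fun v => ?_⟩
      have h1 : G 0 = (2 : ℝ) • e := rfl
      have h2 := norm_sub_sq_real v e
      rw [h0, h1, inner_smul_left, inner_sub_right, real_inner_self_eq_norm_sq,
        real_inner_comm, h2]
      simp only [conj_trivial]
      ring
    | succ k ih =>
      obtain ⟨B, hB, ih⟩ := ih
      refine ⟨B + (1 / 4) ^ k / 4, ?_, fun v => ?_⟩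
      · rw [pow_succ]
        linarith [show (0 : ℝ) < (1 / 4) ^ k by positivity]
      · have h2 := norm_add_sq_real (v - e) (e - (u k).dir)
        rw [sub_add_sub_cancel] at h2
        rw [hu, hG, nextPen, nextPen, inner_add_left, inner_smul_left, h2,
          real_inner_comm (v - e) (e - (u k).dir)]
        simp only [conj_trivial]
        linear_combination ih v

end SearchState

open SearchState in
theorem exists_differentiableAt_of_hasWedges [CompleteSpace E] {f : E → ℝ} {M : ℝ → Set E}
    (hf : LipschitzWith 1 f) (hclosed : ∀ t, IsClosed (M t))
    (hmono : ∀ s t, 0 ≤ s → s ≤ t → t ≤ 1 → M s ⊆ M t) (hne : (M 0).Nonempty)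
    (hwedge : ∀ s t, 0 ≤ s → s < t → t ≤ 1 → ∀ x ∈ M s, HasWedges x (M t)) :
    ∃ x ∈ M 1, DifferentiableAt ℝ f x := by
  obtain ⟨u, h0, hv, hs⟩ := exists_seq hf hne
  obtain ⟨x, e, hdiff, he, hlim⟩ := exists_limit hv hs hf hclosed hmono
  have hlvl : ∀ k, 0 < (u k).lvl := by
    intro k
    obtain ⟨l, hl0, hl, -⟩ := (hv k).mem
    linarith
  refine ⟨x, hmono _ 1 (hlvl 0).le (hv 0).lvl_le le_rfl (hlim 0).1, ?_⟩
  obtain ⟨g, G, hg, hGlim, hG⟩ := exists_pen_expansion h0 (fun k => (hs k).pen_eq) he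
    (fun k => (hlim k).2.2.1.trans (by
      have : (1 / 4 : ℝ) ^ k ≤ 1 := pow_le_one₀ (by norm_num) (by norm_num)
      linarith))
  by_contra hnd
  obtain ⟨y₀, hy₀, hinc⟩ := exists_increase_of_not_hasFDerivAt hf he hg hdiff.hasLineDerivAt
    (fun h => hnd h.differentiableAt)
  obtain ⟨k, hk1, hk2⟩ : ∃ k : ℕ, (1 / 4 : ℝ) ^ k < y₀ / 2 ∧ ‖g - G (k + 1)‖ ≤ y₀ / 2 := by
    have h1 : Tendsto (fun j : ℕ => (1 / 4 : ℝ) ^ j) atTop (𝓝 0) :=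
      tendsto_pow_atTop_nhds_zero_of_lt_one (by norm_num) (by norm_num)
    have h2 := tendsto_iff_norm_sub_tendsto_zero.1 ((tendsto_add_atTop_iff_nat 1).2 hGlim)
    obtain ⟨k, hk1, hk2⟩ := ((h1.eventually_lt_const (half_pos hy₀)).and
      (h2.eventually_lt_const (half_pos hy₀))).exists
    exact ⟨k, hk1, by rw [norm_sub_rev]; exact hk2.le⟩
  obtain ⟨hxM, hxr, hek, hgain, hpow⟩ := hlim k
  have hgain' := (hlim (k + 1)).2.2.2.1
  set σ : ℝ := (1 / 4) ^ k with hσdef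
  have hσ : 0 < σ := by positivity
  have hσ1 : σ ≤ 1 := pow_le_one₀ (by norm_num) (by norm_num)
  have hwc : 0 < wedgeConst := by linarith [wedgeConst_ge]
  obtain ⟨δ, hδ, htrans⟩ := exists_incDiff_pow_four_le (m := wedgeConst * y₀ / 2) hf
    (hv k).diff.hasLineDerivAt hdiff.hasLineDerivAt (hv k).norm_dir_le he wedgeConst_ge hgain hσ
    (by positivity) hek ((hv k).abs_lineDeriv_sub_le hf hσ hgain) hpow
  obtain ⟨x', hx', e', D, hdist, he', hD, hY, hpow'⟩ := hinc
    (M (((u k).lvl + (u (k + 1)).lvl) / 2))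
    (hwedge (u (k + 1)).lvl _ (hlvl _).le (by linarith [(hs k).lvl_lt])
      (by linarith [(hs k).lvl_lt, (hv k).lvl_le]) x (hlim (k + 1)).1)
    (min δ ((u k).rad - ‖x - (u k).pt‖)) (lt_min hδ (by linarith))
  obtain ⟨B, hB, hpen⟩ := hG (k + 1)
  have hD' := hD.lineDeriv
  set Y := D - lineDeriv ℝ f x e - inner ℝ g (e' - e) - 2 * ‖e' - e‖ ^ 2 with hYdef
  set b := D - (u (k + 1)).pen e' - (lineDeriv ℝ f x e - (u (k + 1)).pen e) with hb
  have hYb : Y ≤ 2 * b := by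
    have h1 : |inner ℝ (g - G (k + 1)) (e' - e)| ≤ y₀ / 2 * 1 :=
      (abs_real_inner_le_norm _ _).trans (by gcongr)
    rw [inner_sub_left] at h1
    have h2 := hpen e'
    have h3 : B * ‖e' - e‖ ^ 2 ≤ 2 * ‖e' - e‖ ^ 2 := by gcongr
    have h4 := (abs_le.1 h1).1
    linarith
  have hg' : (u k).gain f σ x' e' = (u k).gain f σ x e + b := by
    rw [hb, gain, gain, (hs k).pen_eq, hD']
    ring
  have hcand : IsCandidate f M σ (u k) x' e' := by
    refine ⟨⟨_, ?_, ?_, hx'⟩, hD.lineDifferentiableAt, ?_, ?_, σ - wedgeConst * y₀ / 2, ?_,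
      fun t => ?_⟩
    · linarith [hlvl k, hlvl (k + 1)]
    · linarith [(hs k).lvl_lt]
    · have := norm_sub_le_norm_sub_add_norm_sub x' x (u k).pt
      linarith [hdist.trans_le (min_le_right _ _)]
    · linarith
    · have : 0 < wedgeConst * y₀ / 2 := by positivity
      linarith
    · refine (htrans x' (hdist.trans_le (min_le_left _ _)) (b / 2) (by linarith)
        (fun t => (hpow' t).trans ?_) t).trans ?_
      · refine mul_le_mul_of_nonneg_right ?_ (by positivity)
        nlinarith
      · refine mul_le_mul_of_nonneg_right ?_ (by positivity)
        rw [max_eq_left (by nlinarith), hg']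
        nlinarith
  have h1 := (hs k).near_max x' e' hcand
  have h2 : (σ / 4) ^ 3 / 10 ^ 13 ≤ σ := by
    have : σ ^ 3 ≤ σ := by nlinarith [mul_pos hσ hσ]
    ring_nf
    linarith
  rw [gain, nextPen] at hgain'
  have h3 : 0 ≤ (1 / 4 : ℝ) ^ (k + 1) / 4 * ‖e - (u (k + 1)).dir‖ ^ 2 := by positivity
  linarith

/-- The union of all segments with endpoints in `A`. -/
def segments (A : Set E) : Set E := ⋃ a ∈ A, ⋃ b ∈ A, segment ℝ a b

lemma segment_subset_segments {A : Set E} {a b : E} (ha : a ∈ A) (hb : b ∈ A) :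
    segment ℝ a b ⊆ segments A :=
  fun _ h => mem_biUnion ha (mem_biUnion hb h)

lemma segments_mono {A B : Set E} (h : A ⊆ B) : segments A ⊆ segments B :=
  biUnion_mono h fun _ _ => biUnion_mono h fun _ _ => subset_rfl

lemma isCompact_segments {A : Set E} (hA : A.Finite) : IsCompact (segments A) :=
  hA.isCompact_biUnion fun a _ => hA.isCompact_biUnion fun b _ => by
    rw [← convexHull_pair]
    exact (toFinite {a, b}).isCompact_convexHull ℝ

lemma measure_segments_eq_zero [FiniteDimensional ℝ E] [MeasurableSpace E] [BorelSpace E]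
    (μ : Measure E) [μ.IsAddHaarMeasure] (hE : 2 ≤ Module.finrank ℝ E) {A : Set E}
    (hA : A.Finite) : μ (segments A) = 0 := by
  refine (measure_biUnion_null_iff hA.countable).2 fun a _ =>
    (measure_biUnion_null_iff hA.countable).2 fun b _ => ?_
  refine measure_mono_null (t := (affineSpan ℝ {a, b} : AffineSubspace ℝ E)) ?_
    (Measure.addHaar_affineSubspace μ _ fun h => ?_)
  · rw [← convexHull_pair]
    exact convexHull_subset_affineSpan _
  · have h1 := collinear_iff_finrank_le_one.1 (collinear_pair ℝ a b)
    rw [← direction_affineSpan, h, AffineSubspace.direction_top, finrank_top] at h1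
    omega

/-- The points which for every `k ≥ 1` are within `t * w n` of `L n` for some
`k ≤ n ≤ (1 + t) * k`. -/
def levelSet {X : Type*} [PseudoMetricSpace X] (L : ℕ → Set X) (w : ℕ → ℝ) (t : ℝ) :
    Set X :=
  ⋂ k : ℕ, ⋃ n ∈ {n : ℕ | k + 1 ≤ n ∧ (n : ℝ) ≤ (1 + t) * (k + 1)},
    Metric.cthickening (t * w n) (L n)

lemma mem_levelSet {X : Type*} [PseudoMetricSpace X] {L : ℕ → Set X} {w : ℕ → ℝ}
    {t : ℝ} {x : X} :
    x ∈ levelSet L w t ↔ ∀ k : ℕ, ∃ n : ℕ, k + 1 ≤ n ∧ (n : ℝ) ≤ (1 + t) * (k + 1) ∧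
      x ∈ Metric.cthickening (t * w n) (L n) := by
  simp [levelSet, and_assoc]

lemma finite_levels (t : ℝ) (k : ℕ) :
    {n : ℕ | k + 1 ≤ n ∧ (n : ℝ) ≤ (1 + t) * (k + 1)}.Finite :=
  (finite_Iic ⌊(1 + t) * (k + 1)⌋₊).subset fun _ h => Nat.le_floor h.2

lemma isClosed_levelSet {X : Type*} [PseudoMetricSpace X] (L : ℕ → Set X) (w : ℕ → ℝ)
    (t : ℝ) : IsClosed (levelSet L w t) :=
  isClosed_iInter fun k => (finite_levels t k).isClosed_biUnion fun _ _ =>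
    Metric.isClosed_cthickening

lemma levelSet_mono {X : Type*} [PseudoMetricSpace X] {L : ℕ → Set X} {w : ℕ → ℝ}
    (hw : ∀ n, 0 ≤ w n) {s t : ℝ} (h : s ≤ t) :
    levelSet L w s ⊆ levelSet L w t := by
  intro x hx
  rw [mem_levelSet] at hx ⊢
  intro k
  obtain ⟨n, h1, h2, h3⟩ := hx k
  refine ⟨n, h1, h2.trans (by gcongr), Metric.cthickening_mono ?_ _ h3⟩
  exact mul_le_mul_of_nonneg_right h (hw n)

lemma isCompact_levelSet [FiniteDimensional ℝ E] {L : ℕ → Set E} (hL : ∀ n, IsCompact (L n))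
    (w : ℕ → ℝ) (t : ℝ) : IsCompact (levelSet L w t) := by
  have := FiniteDimensional.proper ℝ E
  exact ((finite_levels t 0).isCompact_biUnion fun n _ => (hL n).cthickening).of_isClosed_subset
    (isClosed_levelSet L w t) (iInter_subset _ 0)

lemma measure_levelSet_eq_zero {X : Type*} [PseudoMetricSpace X] [MeasurableSpace X]
    {μ : Measure X} {L : ℕ → Set X} {w : ℕ → ℝ}
    (h : ∀ n, μ (Metric.cthickening (w n) (L n)) ≤ 2⁻¹ ^ n) : μ (levelSet L w 1) = 0 := by
  refine measure_mono_null (t := {x | ∃ᶠ n in atTop, x ∈ Metric.cthickening (w n) (L n)}) ?_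
    (measure_setOfPred_frequently_eq_zero ?_)
  · intro x hx
    rw [mem_levelSet] at hx
    refine frequently_atTop.2 fun k => ?_
    obtain ⟨n, h1, -, h3⟩ := hx k
    exact ⟨n, by omega, by rwa [one_mul] at h3⟩
  · refine ((ENNReal.tsum_le_tsum h).trans_lt ?_).ne
    rw [ENNReal.tsum_geometric_two]
    exact ENNReal.ofNat_lt_top

lemma hasWedges_levelSet {A : ℕ → Set E} {w : ℕ → ℝ} (hA : Monotone A) (hw : ∀ n, 0 < w n)
    (hw' : ∀ n, w (n + 1) ≤ w n / 2)
    (hnet : ∀ (n : ℕ) (y : E), ‖y‖ ≤ n + 1 → ∃ a ∈ A (n + 1), ‖a - y‖ ≤ w n / (n + 1))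
    {s t : ℝ} (hs : 0 ≤ s) (hst : s < t) (ht : t ≤ 1) {x : E}
    (hx : x ∈ levelSet (fun n => segments (A n)) w s) :
    HasWedges x (levelSet (fun n => segments (A n)) w t) := by
  intro η hη
  have hanti : Antitone w := antitone_nat_of_succ_le fun n => by linarith [hw' n, hw n]
  have hlim : Tendsto w atTop (𝓝 0) := by
    have h1 : ∀ n, w n ≤ w 0 * (1 / 2) ^ n := by
      intro n
      induction n with
      | zero => simp
      | succ n ih => rw [pow_succ]; linarith [hw' n]
    have h2 := (tendsto_pow_atTop_nhds_zero_of_lt_one (r := (1 / 2 : ℝ)) (by norm_num)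
      (by norm_num)).const_mul (w 0)
    rw [mul_zero] at h2
    exact squeeze_zero (fun n => (hw n).le) h1 h2
  set ψ := t - s with hψdef
  have hψ : 0 < ψ := sub_pos.2 hst
  obtain ⟨N, hN⟩ := exists_nat_ge (max ‖x‖ (max (2 / ψ) (2 / (ψ * η))))
  have hNx : ‖x‖ ≤ N := (le_max_left _ _).trans hN
  have hN1 : 2 / ψ ≤ N := (le_max_left _ _).trans ((le_max_right _ _).trans hN)
  have hN2 : 2 / (ψ * η) ≤ N := (le_max_right _ _).trans ((le_max_right _ _).trans hN)
  rw [div_le_iff₀ hψ] at hN1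
  rw [div_le_iff₀ (by positivity)] at hN2
  refine ⟨min 1 (ψ * w N / 2), by have := hw N; positivity, fun ρ hρ hρ' y₁ y₂ y₃ h₁ h₂ h₃ => ?_⟩
  have hρ1 : ρ < 1 := hρ'.trans_le (min_le_left _ _)
  have hρ2 : 2 * ρ < ψ * w N := by linarith [hρ'.trans_le (min_le_right _ _)]
  have hex : ∃ n, ψ * w n < 2 * ρ := by
    have h := hlim.const_mul ψ
    rw [mul_zero] at h
    exact (h.eventually_lt_const (by linarith)).exists
  classical
  set m := Nat.find hex with hm
  have hm1 : ψ * w m < 2 * ρ := Nat.find_spec hex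
  have hm2 : ∀ n < m, 2 * ρ ≤ ψ * w n := fun n hn => not_lt.1 (Nat.find_min hex hn)
  have hNm : N < m := by
    by_contra! h
    have := mul_le_mul_of_nonneg_left (hanti h) hψ.le
    linarith
  have hNm' : (N : ℝ) + 1 ≤ m := by exact_mod_cast hNm
  have hspace : ∀ y, ‖y - x‖ ≤ ρ → ∃ a ∈ A (m + 1), ‖a - y‖ ≤ η * ρ ∧ ‖a - x‖ ≤ 2 * ρ := by
    intro y hy
    obtain ⟨a, ha, hay⟩ := hnet m y (by
      have := norm_le_norm_add_norm_sub' y x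
      linarith)
    have h1 : ‖a - y‖ * (ψ * (m + 1)) ≤ 2 * ρ := by
      rw [le_div_iff₀ (by positivity)] at hay
      nlinarith
    have h2 : ‖a - y‖ ≤ η * ρ := by
      by_contra! h
      have : η * ρ * (ψ * (m + 1)) < ‖a - y‖ * (ψ * (m + 1)) := by gcongr
      nlinarith [mul_pos hψ hη, mul_pos (mul_pos hψ hη) hρ]
    have h3 : ‖a - y‖ ≤ ρ := by
      by_contra! h
      have : ρ * (ψ * (m + 1)) < ‖a - y‖ * (ψ * (m + 1)) := by gcongr
      nlinarith [mul_pos hψ hρ]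
    have := norm_sub_le_norm_sub_add_norm_sub a y x
    exact ⟨a, ha, h2, by linarith⟩
  have hseg : ∀ a b, a ∈ A (m + 1) → b ∈ A (m + 1) → ‖a - x‖ ≤ 2 * ρ → ‖b - x‖ ≤ 2 * ρ →
      segment ℝ a b ⊆ levelSet (fun n => segments (A n)) w t := by
    intro a b ha hb hax hbx p hp
    have hpx : dist p x ≤ 2 * ρ :=
      (convex_closedBall x (2 * ρ)).segment_subset (by rwa [mem_closedBall_iff_norm])
        (by rwa [mem_closedBall_iff_norm]) hp
    rw [mem_levelSet] at hx ⊢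
    intro k
    obtain ⟨n, hn1, hn2, hn3⟩ := hx k
    rcases lt_or_ge n m with hnm | hnm
    · refine ⟨n, hn1, hn2.trans (by gcongr), ?_⟩
      have h1 := Metric.cthickening_cthickening_subset (by linarith : 0 ≤ 2 * ρ)
        (mul_nonneg hs (hw n).le) _ (Metric.mem_cthickening_of_dist_le p x (2 * ρ) _ hn3 hpx)
      refine Metric.cthickening_mono ?_ _ h1
      have := hm2 n hnm
      rw [hψdef] at this
      linarith
    · have hmn : (m : ℝ) ≤ n := by exact_mod_cast hnm
      refine ⟨max (k + 1) (m + 1), le_max_left _ _, ?_, Metric.self_subset_cthickening _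
        (segments_mono (hA (le_max_right _ _)) (segment_subset_segments ha hb hp))⟩
      have h2 : (m : ℝ) ≤ 2 * (k + 1) := by nlinarith
      have h3 : 1 ≤ ψ * (k + 1) := by nlinarith
      push_cast
      refine max_le (by nlinarith) ?_
      have : (1 + t) * ((k : ℝ) + 1) = (1 + s) * (k + 1) + ψ * (k + 1) := by rw [hψdef]; ring
      linarith
  obtain ⟨a₁, ha₁, h₁, h₁'⟩ := hspace y₁ h₁
  obtain ⟨a₂, ha₂, h₂, h₂'⟩ := hspace y₂ h₂
  obtain ⟨a₃, ha₃, h₃, h₃'⟩ := hspace y₃ h₃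
  exact ⟨a₁, a₂, a₃, h₁, h₂, h₃, hseg _ _ ha₁ ha₂ h₁' h₂', hseg _ _ ha₂ ha₃ h₂' h₃'⟩

lemma exists_nets [FiniteDimensional ℝ E] [MeasurableSpace E] [BorelSpace E]
    (μ : Measure E) [μ.IsAddHaarMeasure] (hE : 2 ≤ Module.finrank ℝ E) :
    ∃ (A : ℕ → Set E) (w : ℕ → ℝ), Monotone A ∧ 0 ∈ A 0 ∧ (∀ n, (A n).Finite) ∧ (∀ n, 0 < w n) ∧
      (∀ n, w (n + 1) ≤ w n / 2) ∧
      (∀ (n : ℕ) (y : E), ‖y‖ ≤ n + 1 → ∃ a ∈ A (n + 1), ‖a - y‖ ≤ w n / (n + 1)) ∧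
      ∀ n, μ (Metric.cthickening (w n) (segments (A n))) ≤ 2⁻¹ ^ n := by
  have := FiniteDimensional.proper ℝ E
  have hwidth : ∀ (n : ℕ) (A : Set E), A.Finite → ∀ w₀ : ℝ, 0 < w₀ →
      ∃ w, 0 < w ∧ w ≤ w₀ ∧ μ (Metric.cthickening w (segments A)) ≤ 2⁻¹ ^ n := by
    intro n A hA w₀ hw₀
    have h := tendsto_measure_cthickening_of_isCompact (μ := μ) (isCompact_segments hA)
    rw [measure_segments_eq_zero μ hE hA] at h
    have h' : ∀ᶠ w in 𝓝[>] (0 : ℝ), μ (Metric.cthickening w (segments A)) < 2⁻¹ ^ n :=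
      (h.mono_left nhdsWithin_le_nhds).eventually_lt_const (ENNReal.pow_pos (by simp) n)
    obtain ⟨w, h1, h2⟩ := (h'.and (Ioc_mem_nhdsGT hw₀)).exists
    exact ⟨w, h2.1, h2.2, h1.le⟩
  let P : ℕ → Set E × ℝ → Prop := fun n p =>
    p.1.Finite ∧ 0 < p.2 ∧ μ (Metric.cthickening p.2 (segments p.1)) ≤ 2⁻¹ ^ n
  have hnext : ∀ (n : ℕ) (p : {p // P n p}), ∃ p' : {p // P (n + 1) p}, p.1.1 ⊆ p'.1.1 ∧
      p'.1.2 ≤ p.1.2 / 2 ∧ ∀ y : E, ‖y‖ ≤ n + 1 → ∃ a ∈ p'.1.1, ‖a - y‖ ≤ p.1.2 / (n + 1) := by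
    rintro n ⟨⟨A, w⟩, hA, hw, -⟩
    obtain ⟨B, -, hB, hcov⟩ := (isCompact_closedBall (0 : E) (n + 1)).finite_cover_balls
      (show 0 < w / (n + 1) by simp only at hw; positivity)
    obtain ⟨w', h1, h2, h3⟩ := hwidth (n + 1) (A ∪ B) (hA.union hB) (w / 2) (half_pos hw)
    refine ⟨⟨(A ∪ B, w'), hA.union hB, h1, h3⟩, subset_union_left, h2, fun y hy => ?_⟩
    obtain ⟨a, ha, hya⟩ := mem_iUnion₂.1 (hcov (mem_closedBall_zero_iff.2 hy))
    exact ⟨a, Or.inr ha, by rw [norm_sub_rev]; exact (mem_ball_iff_norm.1 hya).le⟩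
  obtain ⟨w₀, h1, -, h3⟩ := hwidth 0 {0} (finite_singleton 0) 1 one_pos
  choose nx hnx using hnext
  let u : ∀ n : ℕ, {p // P n p} := fun n => Nat.rec ⟨({0}, w₀), finite_singleton 0, h1, h3⟩ nx n
  exact ⟨fun n => (u n).1.1, fun n => (u n).1.2, monotone_nat_of_le_succ fun n => (hnx n (u n)).1,
    rfl, fun n => (u n).2.1, fun n => (u n).2.2.1, fun n => (hnx n (u n)).2.1,
    fun n => (hnx n (u n)).2.2, fun n => (u n).2.2.2⟩

/-- In dimension at least two there is a compact null set containing a differentiability point of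
every Lipschitz function. -/
theorem exists_isCompact_null_forall_exists_differentiableAt [FiniteDimensional ℝ E]
    [MeasurableSpace E] [BorelSpace E] (μ : Measure E) [μ.IsAddHaarMeasure]
    (hE : 2 ≤ Module.finrank ℝ E) :
    ∃ S : Set E, IsCompact S ∧ μ S = 0 ∧ ∀ g : E → ℝ, (∃ K : ℝ≥0, LipschitzWith K g) →
      ∃ x ∈ S, DifferentiableAt ℝ g x := by
  have := FiniteDimensional.complete ℝ E
  obtain ⟨A, w, hA, h0, hfin, hw, hw', hnet, hμ⟩ := exists_nets μ hE
  refine ⟨levelSet (fun n => segments (A n)) w 1,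
    isCompact_levelSet (fun n => isCompact_segments (hfin n)) w 1, measure_levelSet_eq_zero hμ, ?_⟩
  rintro g ⟨K, hg⟩
  have hK : (0 : ℝ) < K + 1 := by positivity
  have hf : LipschitzWith 1 fun x => ((K : ℝ) + 1)⁻¹ * g x := by
    refine LipschitzWith.of_dist_le_mul fun a b => ?_
    have h := hg.dist_le_mul a b
    rw [Real.dist_eq] at h ⊢
    rw [← mul_sub, abs_mul, abs_of_pos (inv_pos.2 hK), NNReal.coe_one, one_mul,
      inv_mul_le_iff₀ hK]
    refine h.trans ?_
    gcongr
    linarith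
  obtain ⟨x, hx, hdiff⟩ := exists_differentiableAt_of_hasWedges hf
    (isClosed_levelSet (fun n => segments (A n)) w)
    (fun s t _ h _ => levelSet_mono (fun n => (hw n).le) h)
    ⟨0, mem_levelSet.2 fun k => ⟨k + 1, le_rfl, by push_cast; linarith,
      Metric.self_subset_cthickening _ (segment_subset_segments (hA (Nat.zero_le _) h0)
        (hA (Nat.zero_le _) h0) (left_mem_segment ℝ 0 0))⟩⟩
    (fun s t h1 h2 h3 x hx => hasWedges_levelSet hA hw hw' hnet h1 h2 h3 hx)
  refine ⟨x, hx, ?_⟩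
  have h := hdiff.const_mul ((K : ℝ) + 1)
  simpa only [mul_inv_cancel_left₀ hK.ne'] using h

end

/-- Main theorem (Doré–Maleva): for `n ≥ 2` there is a compact Lebesgue-null set
`S ⊆ ℝ^n` containing a point of (Fréchet) differentiability of every real-valued
Lipschitz function on `ℝ^n`. -/
theorem stmt19 (n : ℕ) (hn : 2 ≤ n) :
    ∃ S : Set (EuclideanSpace ℝ (Fin n)), IsCompact S ∧ volume S = 0 ∧
      ∀ g : EuclideanSpace ℝ (Fin n) → ℝ, (∃ K : NNReal, LipschitzWith K g) →
        ∃ x ∈ S, DifferentiableAt ℝ g x := by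
  exact exists_isCompact_null_forall_exists_differentiableAt volume (by simpa using hn)
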